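/- arXiv:1306.4520 — 5 statements merged into one kernel-verified Lean document; each statement's English description precedes it below -/
import Mathlib

section
/- Perturbed supersolution lemma (Lemma 3.1): Under the stated assumptions on H = L + I and the data, let (u_1⁺,…,u_d⁺) with u_i⁺ ∈ LSC_p be a viscosity supersolution of the system (S). Then for every γ > 0 there exists λ₀ > 0, independent of θ, such that for every θ ≥ 0 and every λ ≥ λ₀, the vector (ū_1⁺,…,ū_d⁺) defined by ū_i⁺(x,t) = u_i⁺(x,t) + θ e^{−λt}(|x|^{2γ+2} + 1), i = 1,…,d, is again a viscosity supersolution of (S). -/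
open MeasureTheory Set Filter Real
open scoped Topology

noncomputable section

abbrev Euc (n : ℕ) : Type := EuclideanSpace ℝ (Fin n)

/-- Spatial partial derivative `∂_{x_k} φ(x,t)`. -/
noncomputable def pd1 {N : ℕ} (φ : Euc N → ℝ → ℝ) (x : Euc N) (t : ℝ) (k : Fin N) : ℝ :=
  fderiv ℝ (fun x' => φ x' t) x (EuclideanSpace.single k 1)

/-- Second spatial partial derivative `∂_{x_k x_m} φ(x,t)`. -/
noncomputable def pd2 {N : ℕ} (φ : Euc N → ℝ → ℝ) (x : Euc N) (t : ℝ) (k m : Fin N) : ℝ :=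
  fderiv ℝ (fun x' => pd1 φ x' t m) x (EuclideanSpace.single k 1)

/-- Time derivative `∂_t φ(x,t)`. -/
noncomputable def pdt {N : ℕ} (φ : Euc N → ℝ → ℝ) (x : Euc N) (t : ℝ) : ℝ :=
  deriv (fun s => φ x s) t

/-- `φ ∈ C^{1,2}(ℝ^N × [0,T))`. -/
def IsC12 {N : ℕ} (T : ℝ) (φ : Euc N → ℝ → ℝ) : Prop :=
  (∀ t ∈ Ico (0:ℝ) T, ContDiff ℝ 2 (fun x => φ x t)) ∧
  (∀ x : Euc N, ∀ t ∈ Ico (0:ℝ) T, DifferentiableAt ℝ (fun s => φ x s) t) ∧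
  ContinuousOn (fun p : Euc N × ℝ => φ p.1 p.2) (univ ×ˢ Ico 0 T)

/-- The local (degenerate parabolic) operator `L`. -/
noncomputable def Lop {N : ℕ} (σ : Euc N → ℝ → Matrix (Fin N) (Fin N) ℝ)
    (a : Euc N → ℝ → Fin N → ℝ) (φ : Euc N → ℝ → ℝ) (x : Euc N) (t : ℝ) : ℝ :=
  (∑ k : Fin N, ∑ m : Fin N, (σ x t * (σ x t).transpose) k m * pd2 φ x t k m)
    + (∑ k : Fin N, a x t k * pd1 φ x t k) + pdt φ x t

/-- The integro-differential kernel `K(x,t,z,φ,p)`. -/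
noncomputable def Kker {N l : ℕ} (η : Euc N → ℝ → Euc l → Euc N)
    (x : Euc N) (t : ℝ) (z : Euc l) (φ : Euc N → ℝ → ℝ) (p : Fin N → ℝ) : ℝ :=
  φ (x + η x t z) t - φ x t - (if ‖z‖ ≤ 1 then ∑ k : Fin N, η x t z k * p k else 0)

/-- The small-jumps part `I_κ` of the non-local operator. -/
noncomputable def Ismall {N l : ℕ} (ν : Measure (Euc l)) (η : Euc N → ℝ → Euc l → Euc N)
    (κ : ℝ) (φ : Euc N → ℝ → ℝ) (p : Fin N → ℝ) (x : Euc N) (t : ℝ) : ℝ :=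
  ∫ z in {z : Euc l | 0 < ‖z‖ ∧ ‖z‖ < κ}, Kker η x t z φ p ∂ν

/-- The large-jumps part `I^κ` of the non-local operator. -/
noncomputable def Ilarge {N l : ℕ} (ν : Measure (Euc l)) (η : Euc N → ℝ → Euc l → Euc N)
    (κ : ℝ) (u : Euc N → ℝ → ℝ) (p : Fin N → ℝ) (x : Euc N) (t : ℝ) : ℝ :=
  ∫ z in {z : Euc l | κ ≤ ‖z‖}, Kker η x t z u p ∂ν

/-- The full non-local operator `I(x,t,φ)`. -/
noncomputable def Iop {N l : ℕ} (ν : Measure (Euc l)) (η : Euc N → ℝ → Euc l → Euc N)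
    (φ : Euc N → ℝ → ℝ) (x : Euc N) (t : ℝ) : ℝ :=
  ∫ z in {z : Euc l | z ≠ 0}, Kker η x t z φ (pd1 φ x t) ∂ν

/-- The operator `H^κ(x,t,φ,u) = Lφ + I_κ(φ,Dφ) + I^κ(u,Dφ)`. -/
noncomputable def Hkop {N l : ℕ} (σ : Euc N → ℝ → Matrix (Fin N) (Fin N) ℝ)
    (a : Euc N → ℝ → Fin N → ℝ) (ν : Measure (Euc l)) (η : Euc N → ℝ → Euc l → Euc N)
    (κ : ℝ) (φ u : Euc N → ℝ → ℝ) (x : Euc N) (t : ℝ) : ℝ :=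
  Lop σ a φ x t + Ismall ν η κ φ (pd1 φ x t) x t + Ilarge ν η κ u (pd1 φ x t) x t

/-- The operator `H = L + I`. -/
noncomputable def Hop {N l : ℕ} (σ : Euc N → ℝ → Matrix (Fin N) (Fin N) ℝ)
    (a : Euc N → ℝ → Fin N → ℝ) (ν : Measure (Euc l)) (η : Euc N → ℝ → Euc l → Euc N)
    (φ : Euc N → ℝ → ℝ) (x : Euc N) (t : ℝ) : ℝ :=
  Lop σ a φ x t + Iop ν η φ x t

/-- Structural assumptions on the operator `H = L + I`. -/
structure OperatorAssumptions (N l : ℕ) (T : ℝ)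
    (σ : Euc N → ℝ → Matrix (Fin N) (Fin N) ℝ) (a : Euc N → ℝ → Fin N → ℝ)
    (ν : Measure (Euc l)) (η : Euc N → ℝ → Euc l → Euc N) : Prop where
  dimN : 1 ≤ N
  diml : 1 ≤ l
  hT : 0 < T
  coeff : ∃ A : ℝ, 1 ≤ A ∧ ∀ (x y : Euc N) (t s : ℝ), t ∈ Icc 0 T → s ∈ Icc 0 T →
    ∀ k m : Fin N,
      |a x t k - a y s k| + |σ x t k m - σ y s k m| ≤ A * ‖x - y‖ ∧
      |a x t k| + |σ x t k m| ≤ A * (1 + ‖x‖)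
  levy_null : ν ({0} : Set (Euc l)) = 0
  levy : ∃ Λ₀ At : ℝ, 0 < Λ₀ ∧ 1 ≤ At ∧
    IntegrableOn (fun z : Euc l => ‖z‖ ^ 2) {z | 0 < ‖z‖ ∧ ‖z‖ ≤ 1} ν ∧
    IntegrableOn (fun z : Euc l => Real.exp (Λ₀ * ‖z‖)) {z | 1 < ‖z‖} ν ∧
    (∫ z in {z : Euc l | 0 < ‖z‖ ∧ ‖z‖ ≤ 1}, ‖z‖ ^ 2 ∂ν)
      + (∫ z in {z : Euc l | 1 < ‖z‖}, Real.exp (Λ₀ * ‖z‖) ∂ν) ≤ At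
  eta_cont : ∀ z : Euc l, Continuous (fun p : Euc N × ℝ => η p.1 p.2 z)
  eta_meas : ∀ (x : Euc N) (t : ℝ), Measurable (fun z => η x t z)
  eta_bound : ∃ B : ℝ, 1 ≤ B ∧ ∀ (x y : Euc N) (t : ℝ) (z : Euc l) (k : Fin N),
    |η x t z k| ≤ B * min ‖z‖ 1 ∧ |η x t z k - η y t z k| ≤ B * min ‖z‖ 1 * ‖x - y‖

/-- Assumptions on the data `ψ_i`, `c_{i,j}`, `g_i`. -/
structure DataAssumptions (N d : ℕ) (T : ℝ)
    (ψ : Fin d → Euc N → ℝ → ℝ) (c : Fin d → Fin d → Euc N → ℝ → ℝ)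
    (g : Fin d → Euc N → ℝ) : Prop where
  dimd : 1 ≤ d
  cont_psi : ∀ i, Continuous (fun p : Euc N × ℝ => ψ i p.1 p.2)
  cont_c : ∀ i j, Continuous (fun p : Euc N × ℝ => c i j p.1 p.2)
  cont_g : ∀ i, Continuous (g i)
  growth : ∃ B γ : ℝ, 1 ≤ B ∧ 1 ≤ γ ∧ ∀ (i j : Fin d) (x : Euc N), ∀ t ∈ Icc (0:ℝ) T,
    |ψ i x t| + |c i j x t| + |g i x| ≤ B * (1 + ‖x‖ ^ γ)
  c_diag : ∀ (i : Fin d) (x : Euc N) (t : ℝ), c i i x t = 0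
  no_loop : ∀ (k : ℕ), ∀ idx : Fin (k + 2) → Fin d, Function.Injective idx →
    ∀ (x : Euc N), ∀ t ∈ Icc (0:ℝ) T, 0 < ∑ m : Fin (k + 2), c (idx m) (idx (m + 1)) x t
  terminal : ∀ (i : Fin d) (x : Euc N), ∀ j ≠ i, -(c i j x T) + g j x ≤ g i x

/-- Membership in `USC_p(ℝ^N × [0,T])`. -/
def USCp {N : ℕ} (T : ℝ) (h : Euc N → ℝ → ℝ) : Prop :=
  UpperSemicontinuousOn (fun p : Euc N × ℝ => h p.1 p.2) (univ ×ˢ Icc 0 T) ∧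
  ∃ c γ : ℝ, 1 ≤ c ∧ 1 ≤ γ ∧ ∀ (x : Euc N), ∀ t ∈ Icc (0:ℝ) T, |h x t| ≤ c * (1 + ‖x‖ ^ γ)

/-- Membership in `LSC_p(ℝ^N × [0,T])`. -/
def LSCp {N : ℕ} (T : ℝ) (h : Euc N → ℝ → ℝ) : Prop :=
  LowerSemicontinuousOn (fun p : Euc N × ℝ => h p.1 p.2) (univ ×ˢ Icc 0 T) ∧
  ∃ c γ : ℝ, 1 ≤ c ∧ 1 ≤ γ ∧ ∀ (x : Euc N), ∀ t ∈ Icc (0:ℝ) T, |h x t| ≤ c * (1 + ‖x‖ ^ γ)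

/-- Membership in `C_p(ℝ^N × [0,T])`. -/
def Cp {N : ℕ} (T : ℝ) (h : Euc N → ℝ → ℝ) : Prop :=
  ContinuousOn (fun p : Euc N × ℝ => h p.1 p.2) (univ ×ˢ Icc 0 T) ∧
  ∃ c γ : ℝ, 1 ≤ c ∧ 1 ≤ γ ∧ ∀ (x : Euc N), ∀ t ∈ Icc (0:ℝ) T, |h x t| ≤ c * (1 + ‖x‖ ^ γ)

/-- Viscosity supersolution of the system (S). -/
def IsSupersol {N l d : ℕ} (T : ℝ) (σ : Euc N → ℝ → Matrix (Fin N) (Fin N) ℝ)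
    (a : Euc N → ℝ → Fin N → ℝ) (ν : Measure (Euc l)) (η : Euc N → ℝ → Euc l → Euc N)
    (ψ : Fin d → Euc N → ℝ → ℝ) (c : Fin d → Fin d → Euc N → ℝ → ℝ)
    (g : Fin d → Euc N → ℝ) (u : Fin d → Euc N → ℝ → ℝ) : Prop :=
  (∀ i, LSCp T (u i)) ∧
  (∀ (i : Fin d) (x : Euc N), g i x ≤ u i x T) ∧
  (∀ (i : Fin d) (x₀ : Euc N) (t₀ : ℝ), t₀ ∈ Ioo (0:ℝ) T →
    ∀ φ : Euc N → ℝ → ℝ, IsC12 T φ → φ x₀ t₀ = u i x₀ t₀ →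
      (∀ (x : Euc N), ∀ t ∈ Ico (0:ℝ) T, φ x t - u i x t ≤ φ x₀ t₀ - u i x₀ t₀) →
      ∀ κ ∈ Ioo (0:ℝ) 1,
        0 ≤ -(Hkop σ a ν η κ φ (u i) x₀ t₀) - ψ i x₀ t₀ ∧
        ∀ j ≠ i, -(c i j x₀ t₀) + u j x₀ t₀ ≤ u i x₀ t₀)

/-- Viscosity subsolution of the system (S). -/
def IsSubsol {N l d : ℕ} (T : ℝ) (σ : Euc N → ℝ → Matrix (Fin N) (Fin N) ℝ)
    (a : Euc N → ℝ → Fin N → ℝ) (ν : Measure (Euc l)) (η : Euc N → ℝ → Euc l → Euc N)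
    (ψ : Fin d → Euc N → ℝ → ℝ) (c : Fin d → Fin d → Euc N → ℝ → ℝ)
    (g : Fin d → Euc N → ℝ) (u : Fin d → Euc N → ℝ → ℝ) : Prop :=
  (∀ i, USCp T (u i)) ∧
  (∀ (i : Fin d) (x : Euc N), u i x T ≤ g i x) ∧
  (∀ (i : Fin d) (x₀ : Euc N) (t₀ : ℝ), t₀ ∈ Ioo (0:ℝ) T →
    ∀ φ : Euc N → ℝ → ℝ, IsC12 T φ → φ x₀ t₀ = u i x₀ t₀ →
      (∀ (x : Euc N), ∀ t ∈ Ico (0:ℝ) T, φ x₀ t₀ - u i x₀ t₀ ≤ φ x t - u i x t) →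
      ∀ κ ∈ Ioo (0:ℝ) 1,
        (-(Hkop σ a ν η κ φ (u i) x₀ t₀) - ψ i x₀ t₀ ≤ 0) ∨
        (∃ j ≠ i, u i x₀ t₀ ≤ -(c i j x₀ t₀) + u j x₀ t₀))

end

noncomputable section

section NormPow

variable {E : Type*} [NormedAddCommGroup E] [InnerProductSpace ℝ E]

/-- The real inner product as a bilinear continuous map. -/
def realInnerCLM (E : Type*) [NormedAddCommGroup E] [InnerProductSpace ℝ E] :
    E →L[ℝ] E →L[ℝ] ℝ := innerSL ℝ

theorem norm_realInnerCLM_apply (x : E) : ‖realInnerCLM E x‖ = ‖x‖ := innerSL_apply_norm ℝ x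

/-- The derivative of the vector field `x ↦ ‖x‖ ^ q • ⟪x, ·⟫`. -/
def normRpowInnerDeriv (E : Type*) [NormedAddCommGroup E] [InnerProductSpace ℝ E] (q : ℝ)
    (x : E) : E →L[ℝ] E →L[ℝ] ℝ :=
  (‖x‖ ^ q) • realInnerCLM E + ((q * ‖x‖ ^ (q - 2)) • realInnerCLM E x).smulRight (realInnerCLM E x)

theorem hasFDerivAt_norm_rpow_of_ne_zero {x : E} (hx : x ≠ 0) (q : ℝ) :
    HasFDerivAt (fun y : E => ‖y‖ ^ q) ((q * ‖x‖ ^ (q - 2)) • realInnerCLM E x) x := by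
  have h := ((hasFDerivAt_id (𝕜 := ℝ) x).norm_sq).rpow_const (p := q / 2) (Or.inl (by simpa using hx))
  have e : (fun y : E => ‖y‖ ^ q) = fun y => (‖id y‖ ^ 2) ^ (q / 2) := by
    funext y
    rw [← Real.rpow_natCast, ← Real.rpow_mul (norm_nonneg _)]
    congr 1
    push_cast
    ring
  rw [e]
  refine h.congr_fderiv ?_
  ext v
  have e2 : (‖x‖ ^ 2) ^ (q / 2 - 1) = ‖x‖ ^ (q - 2) := by
    rw [← Real.rpow_natCast, ← Real.rpow_mul (norm_nonneg _)]
    congr 1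
    push_cast
    ring
  have e3 : realInnerCLM E x v = inner ℝ x v := rfl
  simp [e2, e3]
  ring

theorem norm_normRpowInnerDeriv_le {q : ℝ} (hq : 0 < q) (x : E) :
    ‖normRpowInnerDeriv E q x‖ ≤ (1 + q) * ‖x‖ ^ q := by
  have h1 : ‖(‖x‖ ^ q) • realInnerCLM E‖ ≤ ‖x‖ ^ q := by
    refine ContinuousLinearMap.opNorm_le_bound _ (by positivity) fun v => ?_
    rw [smul_apply, norm_smul, norm_realInnerCLM_apply, Real.norm_of_nonneg (by positivity)]
  have h2 : ‖((q * ‖x‖ ^ (q - 2)) • realInnerCLM E x).smulRight (realInnerCLM E x)‖ ≤ q * ‖x‖ ^ q := by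
    rw [ContinuousLinearMap.norm_smulRight_apply, norm_smul, norm_realInnerCLM_apply,
      Real.norm_of_nonneg (by positivity)]
    rcases eq_or_ne x 0 with rfl | hx
    · simp [Real.zero_rpow hq.ne']
    · have hx' : 0 < ‖x‖ := norm_pos_iff.2 hx
      rw [Real.rpow_sub hx', Real.rpow_two]
      field_simp
      exact le_rfl
  refine (ContinuousLinearMap.opNorm_add_le _ _).trans ((add_le_add h1 h2).trans_eq ?_)
  ring

theorem hasFDerivAt_norm_rpow_smul_innerSL {q : ℝ} (hq : 0 < q) (x : E) :
    HasFDerivAt (fun y : E => (‖y‖ ^ q) • realInnerCLM E y) (normRpowInnerDeriv E q x) x := by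
  rcases eq_or_ne x 0 with rfl | hx
  · have e : normRpowInnerDeriv E q 0 = 0 := by
      ext v w
      simp [normRpowInnerDeriv, Real.zero_rpow hq.ne']
    rw [e]
    refine .of_isLittleO ?_
    have h0 : Tendsto (fun y : E => ‖y‖ ^ q) (𝓝 0) (𝓝 0) := by
      have : Continuous (fun y : E => ‖y‖ ^ q) := continuous_norm.rpow_const fun _ => Or.inr hq.le
      simpa [Real.zero_rpow hq.ne'] using this.tendsto 0
    have h1 : (fun y : E => ‖y‖ ^ q) =o[𝓝 0] (fun _ => (1 : ℝ)) :=
      (Asymptotics.isLittleO_one_iff ℝ).2 h0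
    have h2 : (fun y : E => realInnerCLM E y) =O[𝓝 0] (fun y => y) :=
      Asymptotics.isBigO_of_le _ fun y => by rw [norm_realInnerCLM_apply]
    simpa using h1.smul_isBigO h2
  · refine ((hasFDerivAt_norm_rpow_of_ne_zero hx q).smul
      (realInnerCLM E).hasFDerivAt).congr_fderiv ?_
    rfl

theorem continuous_normRpowInnerDeriv {q : ℝ} (hq : 0 < q) :
    Continuous (normRpowInnerDeriv E q) := by
  have h0 : Continuous (fun y : E => ‖y‖ ^ q) := continuous_norm.rpow_const fun _ => Or.inr hq.le
  refine continuous_iff_continuousAt.2 fun x => ?_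
  rcases eq_or_ne x 0 with rfl | hx
  · have e : normRpowInnerDeriv E q 0 = 0 := by
      ext v w
      simp [normRpowInnerDeriv, Real.zero_rpow hq.ne']
    rw [ContinuousAt, e]
    refine squeeze_zero_norm (E := E →L[ℝ] E →L[ℝ] ℝ) (norm_normRpowInnerDeriv_le hq) ?_
    simpa [Real.zero_rpow hq.ne'] using (h0.const_mul (1 + q)).tendsto (0 : E)
  · have h1 : ContinuousAt (fun y : E => ‖y‖ ^ (q - 2)) x :=
      continuous_norm.continuousAt.rpow_const (Or.inl (norm_ne_zero_iff.2 hx))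
    have h2 : Continuous (fun y : E => realInnerCLM E y) := (realInnerCLM E).continuous
    have h3 : ContinuousAt (fun y : E => (q * ‖y‖ ^ (q - 2)) • realInnerCLM E y) x :=
      (h1.const_mul q).smul h2.continuousAt
    have h4 : ContinuousAt (fun y : E => ContinuousLinearMap.smulRightL ℝ E (E →L[ℝ] ℝ)
        ((q * ‖y‖ ^ (q - 2)) • realInnerCLM E y) (realInnerCLM E y)) x :=
      ((ContinuousLinearMap.smulRightL ℝ E (E →L[ℝ] ℝ)).continuous.continuousAt.comp h3).clm_apply
        h2.continuousAt
    exact ((h0.smul continuous_const).continuousAt).add h4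

theorem fderiv_norm_rpow_eq_const_smul {p : ℝ} (hp : 2 < p) :
    fderiv ℝ (fun x : E => ‖x‖ ^ p) = fun x => p • (‖x‖ ^ (p - 2)) • realInnerCLM E x := by
  funext x
  rw [fderiv_norm_rpow x (by linarith), smul_smul]
  rfl

theorem contDiff_two_norm_rpow {p : ℝ} (hp : 2 < p) : ContDiff ℝ 2 (fun x : E => ‖x‖ ^ p) := by
  have hd (x : E) := (hasFDerivAt_norm_rpow_smul_innerSL (sub_pos.2 hp) x).const_smul p
  rw [show (2 : WithTop ℕ∞) = 1 + 1 by norm_num, contDiff_succ_iff_fderiv,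
    fderiv_norm_rpow_eq_const_smul hp, contDiff_one_iff_fderiv]
  refine ⟨differentiable_norm_rpow (by linarith), by simp, fun x => (hd x).differentiableAt, ?_⟩
  have e : fderiv ℝ (fun x : E => p • (‖x‖ ^ (p - 2)) • realInnerCLM E x) =
      fun x => p • normRpowInnerDeriv E (p - 2) x := funext fun x => (hd x).fderiv
  rw [e]
  exact (continuous_normRpowInnerDeriv (sub_pos.2 hp)).const_smul p

theorem norm_fderiv_fderiv_norm_rpow_le {p : ℝ} (hp : 2 < p) (x : E) :
    ‖fderiv ℝ (fderiv ℝ (fun x : E => ‖x‖ ^ p)) x‖ ≤ p * (p - 1) * ‖x‖ ^ (p - 2) := by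
  have hd := (hasFDerivAt_norm_rpow_smul_innerSL (sub_pos.2 hp) x).const_smul p
  rw [fderiv_norm_rpow_eq_const_smul hp]
  change ‖fderiv ℝ (p • fun x : E => (‖x‖ ^ (p - 2)) • realInnerCLM E x) x‖ ≤ _
  rw [hd.fderiv, mul_assoc]
  refine (ContinuousLinearMap.opNorm_smul_le _ _).trans ?_
  rw [Real.norm_of_nonneg (by linarith)]
  refine mul_le_mul_of_nonneg_left ?_ (by linarith)
  refine (norm_normRpowInnerDeriv_le (sub_pos.2 hp) x).trans_eq ?_
  ring

end NormPow

/-- Second order Taylor estimate on a ball on which the Hessian is bounded. -/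
theorem abs_taylor_two_le {E : Type*} [NormedAddCommGroup E] [NormedSpace ℝ E] {f : E → ℝ}
    (hf : ContDiff ℝ 2 f) {x h : E} {C : ℝ}
    (hC : ∀ y ∈ Metric.closedBall x ‖h‖, ‖fderiv ℝ (fderiv ℝ f) y‖ ≤ C) :
    |f (x + h) - f x - fderiv ℝ f x h| ≤ C * ‖h‖ ^ 2 := by
  have hd : Differentiable ℝ f := hf.differentiable (by norm_num)
  have hd' : Differentiable ℝ (fderiv ℝ f) :=
    (hf.fderiv_right (m := 1) (by norm_num)).differentiable (by norm_num)
  have hx : x ∈ Metric.closedBall x ‖h‖ := Metric.mem_closedBall_self (norm_nonneg _)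
  have hxh : x + h ∈ Metric.closedBall x ‖h‖ := by simp
  have hC0 : 0 ≤ C := (ContinuousLinearMap.opNorm_nonneg _).trans (hC x hx)
  have hconv := convex_closedBall x ‖h‖
  have h1 : ∀ y ∈ Metric.closedBall x ‖h‖, ‖fderiv ℝ f y - fderiv ℝ f x‖ ≤ C * ‖h‖ := by
    intro y hy
    refine (hconv.norm_image_sub_le_of_norm_fderiv_le (𝕜 := ℝ) (fun z _ => hd' z) hC hx hy).trans ?_
    exact mul_le_mul_of_nonneg_left (by simpa [dist_eq_norm] using hy) hC0
  have h2 := hconv.norm_image_sub_le_of_norm_hasFDerivWithin_le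
    (f := fun y => f y - fderiv ℝ f x y) (f' := fun y => fderiv ℝ f y - fderiv ℝ f x)
    (fun y _ => ((hd y).hasFDerivAt.sub (fderiv ℝ f x).hasFDerivAt).hasFDerivWithinAt) h1 hx hxh
  rw [Real.norm_eq_abs] at h2
  have e : f (x + h) - f x - fderiv ℝ f x h =
      f (x + h) - fderiv ℝ f x (x + h) - (f x - fderiv ℝ f x x) := by
    rw [map_add]; ring
  rw [e]
  refine h2.trans_eq ?_
  rw [add_sub_cancel_left]
  ring

theorem abs_pd1_le {N : ℕ} (φ : Euc N → ℝ → ℝ) (x : Euc N) (t : ℝ) (k : Fin N) :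
    |pd1 φ x t k| ≤ ‖fderiv ℝ (fun y => φ y t) x‖ := by
  simpa [pd1] using (fderiv ℝ (fun y => φ y t) x).le_opNorm (EuclideanSpace.single k 1)

theorem sum_mul_pd1 {N : ℕ} (φ : Euc N → ℝ → ℝ) (x v : Euc N) (t : ℝ) :
    ∑ k : Fin N, v k * pd1 φ x t k = fderiv ℝ (fun y => φ y t) x v := by
  have hv : v = ∑ k : Fin N, v k • EuclideanSpace.single k (1 : ℝ) := by
    simpa using ((EuclideanSpace.basisFun (Fin N) ℝ).sum_repr v).symm
  conv_rhs => rw [hv]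
  simp [pd1]

theorem pd2_eq_fderiv_fderiv {N : ℕ} {φ : Euc N → ℝ → ℝ} {t : ℝ}
    (hφ : ContDiff ℝ 2 (fun x => φ x t)) (x : Euc N) (k m : Fin N) :
    pd2 φ x t k m = fderiv ℝ (fderiv ℝ (fun y => φ y t)) x (EuclideanSpace.single k 1)
      (EuclideanSpace.single m 1) := by
  have hd : DifferentiableAt ℝ (fderiv ℝ (fun y => φ y t)) x :=
    ((hφ.fderiv_right (m := 1) (by norm_num)).differentiable (by norm_num)) x
  have h := hd.hasFDerivAt.clm_apply
    (hasFDerivAt_const (EuclideanSpace.single m (1 : ℝ) : Euc N) x)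
  unfold pd2 pd1
  rw [h.fderiv]
  simp

theorem abs_pd2_le {N : ℕ} {φ : Euc N → ℝ → ℝ} {t : ℝ}
    (hφ : ContDiff ℝ 2 (fun x => φ x t)) (x : Euc N) (k m : Fin N) :
    |pd2 φ x t k m| ≤ ‖fderiv ℝ (fderiv ℝ (fun y => φ y t)) x‖ := by
  rw [pd2_eq_fderiv_fderiv hφ]
  simpa using (fderiv ℝ (fderiv ℝ (fun y => φ y t)) x).le_opNorm₂
    (EuclideanSpace.single k 1) (EuclideanSpace.single m 1)

theorem norm_le_card_mul_of_abs_apply_le {N : ℕ} {v : Euc N} {b : ℝ} (h : ∀ k, |v k| ≤ b) :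
    ‖v‖ ≤ N * b := by
  have hv : v = ∑ k : Fin N, v k • EuclideanSpace.single k (1 : ℝ) := by
    simpa using ((EuclideanSpace.basisFun (Fin N) ℝ).sum_repr v).symm
  calc ‖v‖ = ‖∑ k : Fin N, v k • EuclideanSpace.single k (1 : ℝ)‖ := by rw [← hv]
    _ ≤ ∑ _k : Fin N, b := norm_sum_le_of_le _ fun k _ => by simpa [norm_smul] using h k
    _ = N * b := by simp

theorem pd1_add {N : ℕ} {φ w : Euc N → ℝ → ℝ} {t : ℝ}
    (hφ : Differentiable ℝ (fun x => φ x t)) (hw : Differentiable ℝ (fun x => w x t))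
    (x : Euc N) (k : Fin N) :
    pd1 (fun x t => φ x t + w x t) x t k = pd1 φ x t k + pd1 w x t k := by
  unfold pd1
  rw [fderiv_fun_add (hφ x) (hw x)]
  rfl

theorem differentiable_pd1 {N : ℕ} {φ : Euc N → ℝ → ℝ} {t : ℝ}
    (hφ : ContDiff ℝ 2 (fun x => φ x t)) (k : Fin N) :
    Differentiable ℝ (fun x => pd1 φ x t k) := fun _ =>
  (((hφ.fderiv_right (m := 1) (by norm_num)).differentiable (by norm_num)) _).clm_apply
    (differentiableAt_const _)

theorem pd2_add {N : ℕ} {φ w : Euc N → ℝ → ℝ} {t : ℝ}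
    (hφ : ContDiff ℝ 2 (fun x => φ x t)) (hw : ContDiff ℝ 2 (fun x => w x t))
    (x : Euc N) (k m : Fin N) :
    pd2 (fun x t => φ x t + w x t) x t k m = pd2 φ x t k m + pd2 w x t k m := by
  have h (y : Euc N) := pd1_add (hφ.differentiable (by norm_num)) (hw.differentiable (by norm_num))
    y m
  unfold pd2
  simp only [h]
  rw [fderiv_fun_add (differentiable_pd1 hφ m x) (differentiable_pd1 hw m x)]
  rfl

theorem Lop_add {N : ℕ} (σ : Euc N → ℝ → Matrix (Fin N) (Fin N) ℝ)
    (a : Euc N → ℝ → Fin N → ℝ) {φ w : Euc N → ℝ → ℝ} {x : Euc N} {t : ℝ}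
    (hφ : ContDiff ℝ 2 (fun x => φ x t)) (hw : ContDiff ℝ 2 (fun x => w x t))
    (hφt : DifferentiableAt ℝ (fun s => φ x s) t) (hwt : DifferentiableAt ℝ (fun s => w x s) t) :
    Lop σ a (fun x t => φ x t + w x t) x t = Lop σ a φ x t + Lop σ a w x t := by
  have h1 (k) := pd1_add (hφ.differentiable (by norm_num)) (hw.differentiable (by norm_num)) x k
  have h3 : pdt (fun x t => φ x t + w x t) x t = pdt φ x t + pdt w x t := deriv_fun_add hφt hwt
  simp only [Lop, pd2_add hφ hw, h1, h3, mul_add, Finset.sum_add_distrib]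
  ring

theorem Kker_add {N l : ℕ} (η : Euc N → ℝ → Euc l → Euc N) (x : Euc N) (t : ℝ) (z : Euc l)
    (φ w : Euc N → ℝ → ℝ) (p q : Fin N → ℝ) :
    Kker η x t z (fun x t => φ x t + w x t) (fun k => p k + q k) =
      Kker η x t z φ p + Kker η x t z w q := by
  unfold Kker
  split_ifs <;> simp only [mul_add, Finset.sum_add_distrib] <;> ring

theorem measurable_Kker {N l : ℕ} {η : Euc N → ℝ → Euc l → Euc N} {x : Euc N} {t : ℝ}
    (hη : Measurable (fun z => η x t z)) {u : Euc N → ℝ → ℝ} (hu : Measurable (fun y => u y t))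
    (p : Fin N → ℝ) : Measurable (fun z => Kker η x t z u p) := by
  have h1 : Measurable (fun z => u (x + η x t z) t) := hu.comp (hη.const_add x)
  have h2 : Measurable (fun z => ∑ k : Fin N, η x t z k * p k) :=
    Finset.measurable_sum _ fun k _ =>
      (((EuclideanSpace.proj k : Euc N →L[ℝ] ℝ).continuous.measurable.comp hη).mul_const (p k))
  exact (h1.sub_const _).sub
    (h2.ite (measurableSet_le measurable_norm measurable_const) measurable_const)

theorem abs_Kker_le_of_norm_le_one {N l : ℕ} {η : Euc N → ℝ → Euc l → Euc N} {x : Euc N} {t : ℝ}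
    {z : Euc l} {φ : Euc N → ℝ → ℝ} (hφ : ContDiff ℝ 2 (fun x => φ x t)) {D C : ℝ}
    (hη : ‖η x t z‖ ≤ D * min ‖z‖ 1) (hD : 0 ≤ D) (hz : ‖z‖ ≤ 1)
    (hC : ∀ y ∈ Metric.closedBall x D, ‖fderiv ℝ (fderiv ℝ (fun y => φ y t)) y‖ ≤ C) :
    |Kker η x t z φ (pd1 φ x t)| ≤ C * D ^ 2 * (min ‖z‖ 1) ^ 2 := by
  have hηD : ‖η x t z‖ ≤ D := hη.trans (mul_le_of_le_one_right hD (min_le_right _ _))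
  have hC0 : 0 ≤ C :=
    (ContinuousLinearMap.opNorm_nonneg _).trans (hC x (Metric.mem_closedBall_self hD))
  have h := abs_taylor_two_le hφ (x := x) (h := η x t z)
    fun y hy => hC y (Metric.closedBall_subset_closedBall hηD hy)
  rw [Kker, if_pos hz, sum_mul_pd1]
  refine h.trans ?_
  rw [mul_assoc, ← mul_pow]
  gcongr

theorem integrableOn_min_norm_one_sq {l : ℕ} {ν : Measure (Euc l)} {Λ : ℝ} (hΛ : 0 < Λ)
    (h1 : IntegrableOn (fun z : Euc l => ‖z‖ ^ 2) {z | 0 < ‖z‖ ∧ ‖z‖ ≤ 1} ν)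
    (h2 : IntegrableOn (fun z : Euc l => Real.exp (Λ * ‖z‖)) {z | 1 < ‖z‖} ν) :
    IntegrableOn (fun z : Euc l => (min ‖z‖ 1) ^ 2) {z | 0 < ‖z‖} ν := by
  have hm : Measurable (fun z : Euc l => (min ‖z‖ 1) ^ 2) :=
    (measurable_norm.min measurable_const).pow_const 2
  have e : {z : Euc l | 0 < ‖z‖} = {z | 0 < ‖z‖ ∧ ‖z‖ ≤ 1} ∪ {z | 1 < ‖z‖} := by
    ext z
    simp only [mem_ofPred_eq, mem_union]
    constructor
    · intro h
      rcases le_or_gt ‖z‖ 1 with h' | h'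
      · exact Or.inl ⟨h, h'⟩
      · exact Or.inr h'
    · rintro (h | h)
      · exact h.1
      · exact one_pos.trans h
  rw [e]
  refine IntegrableOn.union (Integrable.mono' h1 hm.aestronglyMeasurable (ae_of_all _ fun z => ?_))
    (Integrable.mono' h2 hm.aestronglyMeasurable (ae_of_all _ fun z => ?_))
  · rw [Real.norm_of_nonneg (by positivity)]
    have : 0 ≤ min ‖z‖ 1 := by positivity
    gcongr
    exact min_le_left _ _
  · rw [Real.norm_of_nonneg (by positivity)]
    have h0 : 0 ≤ min ‖z‖ 1 := by positivity
    calc (min ‖z‖ 1) ^ 2 ≤ 1 := pow_le_one₀ h0 (min_le_right _ _)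
      _ ≤ Real.exp (Λ * ‖z‖) := Real.one_le_exp (by positivity)

theorem integrableOn_Kker_small {N l : ℕ} {ν : Measure (Euc l)} {η : Euc N → ℝ → Euc l → Euc N}
    {x : Euc N} {t D κ : ℝ} {φ : Euc N → ℝ → ℝ} (hφ : ContDiff ℝ 2 (fun x => φ x t))
    (hηm : Measurable (fun z => η x t z)) (hη : ∀ z, ‖η x t z‖ ≤ D * min ‖z‖ 1) (hD : 0 ≤ D)
    (hν : IntegrableOn (fun z : Euc l => (min ‖z‖ 1) ^ 2) {z | 0 < ‖z‖} ν) (hκ : κ ≤ 1) :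
    IntegrableOn (fun z => Kker η x t z φ (pd1 φ x t)) {z | 0 < ‖z‖ ∧ ‖z‖ < κ} ν := by
  have hc : Continuous (fderiv ℝ (fderiv ℝ (fun y => φ y t))) :=
    (hφ.fderiv_right (m := 1) (by norm_num)).continuous_fderiv (by norm_num)
  obtain ⟨C, hC⟩ := (isCompact_closedBall x D).exists_bound_of_continuousOn
    (E := Euc N →L[ℝ] Euc N →L[ℝ] ℝ) hc.continuousOn
  have hS : MeasurableSet {z : Euc l | 0 < ‖z‖ ∧ ‖z‖ < κ} :=
    (measurableSet_lt measurable_const measurable_norm).inter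
      (measurableSet_lt measurable_norm measurable_const)
  refine Integrable.mono' ((hν.mono_set fun z hz => hz.1).const_mul (C * D ^ 2))
    (measurable_Kker hηm hφ.continuous.measurable _).aestronglyMeasurable
    ((ae_restrict_mem hS).mono fun z hz => ?_)
  exact abs_Kker_le_of_norm_le_one hφ (hη z) hD (hz.2.le.trans hκ) hC

theorem integrableOn_Kker_large {N l : ℕ} {ν : Measure (Euc l)} {η : Euc N → ℝ → Euc l → Euc N}
    {x : Euc N} {t D κ c γ : ℝ} {u : Euc N → ℝ → ℝ} (hu : Measurable (fun y => u y t))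
    (hc : 0 ≤ c) (hγ : 0 ≤ γ) (hub : ∀ y, |u y t| ≤ c * (1 + ‖y‖ ^ γ))
    (hηm : Measurable (fun z => η x t z)) (hη : ∀ z, ‖η x t z‖ ≤ D * min ‖z‖ 1) (hD : 0 ≤ D)
    (hν : IntegrableOn (fun z : Euc l => (min ‖z‖ 1) ^ 2) {z | 0 < ‖z‖} ν)
    (hκ : 0 < κ) (hκ1 : κ ≤ 1) (p : Fin N → ℝ) :
    IntegrableOn (fun z => Kker η x t z u p) {z | κ ≤ ‖z‖} ν := by
  have hS : MeasurableSet {z : Euc l | κ ≤ ‖z‖} := measurableSet_le measurable_const measurable_norm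
  set C : ℝ := c * (1 + (‖x‖ + D) ^ γ) + |u x t| + ∑ k, D * |p k| with hCdef
  have hC0 : 0 ≤ C := by positivity
  refine Integrable.mono' ((hν.mono_set fun z hz => hκ.trans_le hz).const_mul (C / κ ^ 2))
    (measurable_Kker hηm hu _).aestronglyMeasurable
    ((ae_restrict_mem hS).mono fun z hz => ?_)
  have hηD : ‖η x t z‖ ≤ D := (hη z).trans (mul_le_of_le_one_right hD (min_le_right _ _))
  have hK : |Kker η x t z u p| ≤ C := by
    have h1 : |u (x + η x t z) t| ≤ c * (1 + (‖x‖ + D) ^ γ) := by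
      refine (hub _).trans ?_
      gcongr
      exact (norm_add_le _ _).trans (by gcongr)
    have h2 : |if ‖z‖ ≤ 1 then ∑ k : Fin N, η x t z k * p k else 0| ≤ ∑ k, D * |p k| := by
      split_ifs
      · refine (Finset.abs_sum_le_sum_abs _ _).trans (Finset.sum_le_sum fun k _ => ?_)
        rw [abs_mul]
        gcongr
        exact (PiLp.norm_apply_le (η x t z) k).trans hηD
      · rw [abs_zero]
        positivity
    exact (abs_sub _ _).trans (add_le_add ((abs_sub _ _).trans (add_le_add h1 le_rfl)) h2)
  have hm : κ ≤ min ‖z‖ 1 := le_min hz hκ1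
  rw [Real.norm_eq_abs]
  refine hK.trans ?_
  rw [div_mul_eq_mul_div, le_div_iff₀ (by positivity)]
  gcongr

theorem Hkop_add {N l : ℕ} {σ : Euc N → ℝ → Matrix (Fin N) (Fin N) ℝ}
    {a : Euc N → ℝ → Fin N → ℝ} {ν : Measure (Euc l)} {η : Euc N → ℝ → Euc l → Euc N} {κ : ℝ}
    {φ w u : Euc N → ℝ → ℝ} {x : Euc N} {t : ℝ}
    (hφ : ContDiff ℝ 2 (fun x => φ x t)) (hw : ContDiff ℝ 2 (fun x => w x t))
    (hφt : DifferentiableAt ℝ (fun s => φ x s) t) (hwt : DifferentiableAt ℝ (fun s => w x s) t)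
    (hφs : IntegrableOn (fun z => Kker η x t z φ (pd1 φ x t)) {z | 0 < ‖z‖ ∧ ‖z‖ < κ} ν)
    (hws : IntegrableOn (fun z => Kker η x t z w (pd1 w x t)) {z | 0 < ‖z‖ ∧ ‖z‖ < κ} ν)
    (hul : IntegrableOn (fun z => Kker η x t z u (pd1 φ x t)) {z | κ ≤ ‖z‖} ν)
    (hwl : IntegrableOn (fun z => Kker η x t z w (pd1 w x t)) {z | κ ≤ ‖z‖} ν) :
    Hkop σ a ν η κ (fun x t => φ x t + w x t) (fun x t => u x t + w x t) x t =
      Hkop σ a ν η κ φ u x t + Hkop σ a ν η κ w w x t := by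
  have h1 : pd1 (fun x t => φ x t + w x t) x t = fun k => pd1 φ x t k + pd1 w x t k :=
    funext fun k => pd1_add (hφ.differentiable (by norm_num)) (hw.differentiable (by norm_num)) x k
  simp only [Hkop, Ismall, Ilarge, Lop_add σ a hφ hw hφt hwt, h1, Kker_add]
  rw [integral_add hφs hws, integral_add hul hwl]
  ring

/-- The barrier `θ e^{-λt} (|x|^p + 1)`. -/
def expBarrier (N : ℕ) (p θ lam : ℝ) (x : Euc N) (t : ℝ) : ℝ :=
  θ * Real.exp (-(lam * t)) * (‖x‖ ^ p + 1)

section Barrier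

variable {N : ℕ} {p θ lam : ℝ}

theorem contDiff_expBarrier (hp : 2 < p) (t : ℝ) :
    ContDiff ℝ 2 (fun x => expBarrier N p θ lam x t) :=
  contDiff_const.mul ((contDiff_two_norm_rpow hp).add contDiff_const)

theorem hasDerivAt_expBarrier (x : Euc N) (t : ℝ) :
    HasDerivAt (fun s => expBarrier N p θ lam x s) (-lam * expBarrier N p θ lam x t) t := by
  have h1 : HasDerivAt (fun s : ℝ => -(lam * s)) (-lam) t := 
    ((hasDerivAt_id t).const_mul lam).neg.congr_deriv (by simp)
  refine ((h1.exp.const_mul θ).mul_const (‖x‖ ^ p + 1)).congr_deriv ?_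
  unfold expBarrier
  ring

theorem continuous_expBarrier (hp : 0 ≤ p) :
    Continuous (fun q : Euc N × ℝ => expBarrier N p θ lam q.1 q.2) := by
  have h1 : Continuous (fun q : Euc N × ℝ => ‖q.1‖ ^ p) :=
    continuous_fst.norm.rpow_const fun _ => Or.inr hp
  unfold expBarrier
  fun_prop

theorem expBarrier_nonneg (hθ : 0 ≤ θ) (x : Euc N) (t : ℝ) : 0 ≤ expBarrier N p θ lam x t := by
  unfold expBarrier
  positivity

theorem isC12_expBarrier (hp : 2 < p) (T : ℝ) : IsC12 T (expBarrier N p θ lam) :=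
  ⟨fun t _ => contDiff_expBarrier hp t,
    fun x t _ => (hasDerivAt_expBarrier x t).differentiableAt,
    (continuous_expBarrier (by linarith)).continuousOn⟩

theorem fderiv_expBarrier (hp : 2 < p) (t : ℝ) :
    fderiv ℝ (fun x => expBarrier N p θ lam x t) =
      fun x => (θ * Real.exp (-(lam * t))) • fderiv ℝ (fun x : Euc N => ‖x‖ ^ p) x := by
  funext x
  have h := ((hasFDerivAt_norm_rpow x (p := p) (by linarith)).differentiableAt.hasFDerivAt.add_const
    1).const_mul (θ * Real.exp (-(lam * t)))
  exact h.fderiv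

theorem norm_fderiv_expBarrier (hp : 2 < p) (hθ : 0 ≤ θ) (x : Euc N) (t : ℝ) :
    ‖fderiv ℝ (fun x => expBarrier N p θ lam x t) x‖ =
      θ * Real.exp (-(lam * t)) * (p * ‖x‖ ^ (p - 1)) := by
  rw [fderiv_expBarrier hp, norm_smul, norm_fderiv_norm_id_rpow x (by linarith),
    Real.norm_of_nonneg (by positivity)]

theorem norm_fderiv_fderiv_expBarrier_le (hp : 2 < p) (hθ : 0 ≤ θ) (x : Euc N) (t : ℝ) :
    ‖fderiv ℝ (fderiv ℝ (fun x => expBarrier N p θ lam x t)) x‖ ≤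
      θ * Real.exp (-(lam * t)) * (p * (p - 1) * ‖x‖ ^ (p - 2)) := by
  have hd : DifferentiableAt ℝ (fderiv ℝ (fun x : Euc N => ‖x‖ ^ p)) x :=
    (((contDiff_two_norm_rpow hp).fderiv_right (m := 1) (by norm_num)).differentiable
      (by norm_num)) x
  have h := hd.hasFDerivAt.const_smul (θ * Real.exp (-(lam * t)))
  rw [fderiv_expBarrier hp]
  change ‖fderiv ℝ ((θ * Real.exp (-(lam * t))) • fderiv ℝ (fun x : Euc N => ‖x‖ ^ p)) x‖ ≤ _
  rw [h.fderiv]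
  refine (ContinuousLinearMap.opNorm_smul_le _ _).trans ?_
  rw [Real.norm_of_nonneg (by positivity)]
  exact mul_le_mul_of_nonneg_left (norm_fderiv_fderiv_norm_rpow_le hp x) (by positivity)

theorem Lop_expBarrier_le {σ : Euc N → ℝ → Matrix (Fin N) (Fin N) ℝ}
    {a : Euc N → ℝ → Fin N → ℝ} {A : ℝ} {x : Euc N} {t : ℝ} (hp : 2 < p) (hθ : 0 ≤ θ)
    (hA : 0 ≤ A) (hσ : ∀ k m, |σ x t k m| ≤ A * (1 + ‖x‖)) (ha : ∀ k, |a x t k| ≤ A * (1 + ‖x‖)) :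
    Lop σ a (expBarrier N p θ lam) x t ≤
      θ * Real.exp (-(lam * t)) * ((N ^ 3 * A ^ 2 * (p * (p - 1)) + N * A * p) * (1 + ‖x‖) ^ p)
        - lam * expBarrier N p θ lam x t := by
  set s := θ * Real.exp (-(lam * t)) with hs
  have hs0 : 0 ≤ s := by positivity
  set X := 1 + ‖x‖ with hX
  have hX0 : 0 < X := by positivity
  have hxX : ‖x‖ ≤ X := by linarith
  have hp1 : 0 ≤ p - 1 := by linarith
  have e2 : X ^ 2 * X ^ (p - 2) = X ^ p := by
    rw [← Real.rpow_two, ← Real.rpow_add hX0]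
    ring_nf
  have e1 : X * X ^ (p - 1) = X ^ p := by
    nth_rewrite 1 [← Real.rpow_one X]
    rw [← Real.rpow_add hX0]
    ring_nf
  have h1 (k m : Fin N) : |(σ x t * (σ x t).transpose) k m| ≤ N * (A * X) ^ 2 := by
    rw [Matrix.mul_apply]
    refine (Finset.abs_sum_le_sum_abs _ _).trans ?_
    calc _ ≤ ∑ _j : Fin N, (A * X) ^ 2 := by
          refine Finset.sum_le_sum fun j _ => ?_
          rw [Matrix.transpose_apply, abs_mul, sq]
          exact mul_le_mul (hσ k j) (hσ m j) (abs_nonneg _) (by positivity)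
      _ = _ := by simp
  have h2 (k m : Fin N) : |pd2 (expBarrier N p θ lam) x t k m| ≤ s * (p * (p - 1) * X ^ (p - 2)) := by
    refine (abs_pd2_le (contDiff_expBarrier hp t) x k m).trans
      ((norm_fderiv_fderiv_expBarrier_le hp hθ x t).trans ?_)
    rw [← hs]
    gcongr
  have h3 (k : Fin N) : |pd1 (expBarrier N p θ lam) x t k| ≤ s * (p * X ^ (p - 1)) := by
    refine (abs_pd1_le _ x t k).trans ((norm_fderiv_expBarrier hp hθ x t).le.trans ?_)
    rw [← hs]
    gcongr
  have h4 : pdt (expBarrier N p θ lam) x t = -lam * expBarrier N p θ lam x t :=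
    (hasDerivAt_expBarrier x t).deriv
  have h5 : ∑ k : Fin N, ∑ m : Fin N,
      (σ x t * (σ x t).transpose) k m * pd2 (expBarrier N p θ lam) x t k m ≤
        s * (N ^ 3 * A ^ 2 * (p * (p - 1)) * X ^ p) := by
    calc _ ≤ ∑ _k : Fin N, ∑ _m : Fin N, N * (A * X) ^ 2 * (s * (p * (p - 1) * X ^ (p - 2))) := by
          refine Finset.sum_le_sum fun k _ => Finset.sum_le_sum fun m _ => ?_
          refine (le_abs_self _).trans ?_
          rw [abs_mul]
          exact mul_le_mul (h1 k m) (h2 k m) (abs_nonneg _) (by positivity)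
      _ = s * (N ^ 3 * A ^ 2 * (p * (p - 1)) * (X ^ 2 * X ^ (p - 2))) := by
          simp
          ring
      _ = _ := by rw [e2]
  have h6 : ∑ k : Fin N, a x t k * pd1 (expBarrier N p θ lam) x t k ≤
      s * (N * A * p * X ^ p) := by
    calc _ ≤ ∑ _k : Fin N, A * X * (s * (p * X ^ (p - 1))) := by
          refine Finset.sum_le_sum fun k _ => ?_
          refine (le_abs_self _).trans ?_
          rw [abs_mul]
          exact mul_le_mul (ha k) (h3 k) (abs_nonneg _) (by positivity)
      _ = s * (N * A * p * (X * X ^ (p - 1))) := by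
          simp
          ring
      _ = _ := by rw [e1]
  rw [Lop, h4]
  linarith

theorem abs_Kker_expBarrier_le {l : ℕ} {η : Euc N → ℝ → Euc l → Euc N} {D : ℝ} {x : Euc N} {t : ℝ}
    {z : Euc l} (hp : 2 < p) (hθ : 0 ≤ θ) (hD : 0 ≤ D) (hη : ‖η x t z‖ ≤ D * min ‖z‖ 1) :
    |Kker η x t z (expBarrier N p θ lam) (pd1 (expBarrier N p θ lam) x t)| ≤
      θ * Real.exp (-(lam * t)) *
        ((p * (p - 1) * D ^ 2 + 2) * (1 + D) ^ p * (1 + ‖x‖) ^ p) * (min ‖z‖ 1) ^ 2 := by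
  set s := θ * Real.exp (-(lam * t)) with hs
  have hs0 : 0 ≤ s := by positivity
  have hp1 : 0 ≤ p - 1 := by linarith
  have hηD : ‖η x t z‖ ≤ D := hη.trans (mul_le_of_le_one_right hD (min_le_right _ _))
  have hR : ‖x‖ + D ≤ (1 + D) * (1 + ‖x‖) := by nlinarith [norm_nonneg x]
  have hR1 : 1 ≤ (1 + D) * (1 + ‖x‖) := by nlinarith [norm_nonneg x]
  have hRp : ((1 + D) * (1 + ‖x‖)) ^ p = (1 + D) ^ p * (1 + ‖x‖) ^ p :=
    Real.mul_rpow (by positivity) (by positivity)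
  rw [mul_assoc (p * (p - 1) * D ^ 2 + 2), ← hRp]
  set R := ((1 + D) * (1 + ‖x‖)) ^ p with hRdef
  have hR0 : 0 ≤ R := by positivity
  rcases le_or_gt ‖z‖ 1 with hz | hz
  · have hC : ∀ y ∈ Metric.closedBall x D,
        ‖fderiv ℝ (fderiv ℝ (fun y => expBarrier N p θ lam y t)) y‖ ≤ s * (p * (p - 1) * R) := by
      intro y hy
      refine (norm_fderiv_fderiv_expBarrier_le hp hθ y t).trans ?_
      have hy1 : ‖y‖ ≤ ‖x‖ + D := by
        have h1 : ‖y - x‖ ≤ D := by simpa [dist_eq_norm] using hy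
        calc ‖y‖ = ‖x + (y - x)‖ := by rw [add_sub_cancel]
          _ ≤ ‖x‖ + D := (norm_add_le _ _).trans (by gcongr)
      have hyR : ‖y‖ ^ (p - 2) ≤ R :=
        (Real.rpow_le_rpow (norm_nonneg _) (hy1.trans hR) (by linarith)).trans
          (Real.rpow_le_rpow_of_exponent_le hR1 (by linarith))
      gcongr
    refine (abs_Kker_le_of_norm_le_one (contDiff_expBarrier hp t) hη hD hz hC).trans ?_
    have : 0 ≤ s * R * (min ‖z‖ 1) ^ 2 := by positivity
    nlinarith
  · have h1 : ‖x + η x t z‖ ^ p ≤ R :=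
      Real.rpow_le_rpow (norm_nonneg _)
        (((norm_add_le _ _).trans (by gcongr)).trans hR) (by linarith)
    have h2 : ‖x‖ ^ p ≤ R :=
      Real.rpow_le_rpow (norm_nonneg _) ((le_add_of_nonneg_right hD).trans hR) (by linarith)
    have h3 : 0 ≤ ‖x + η x t z‖ ^ p := by positivity
    have h4 : 0 ≤ ‖x‖ ^ p := by positivity
    have h5 : |‖x + η x t z‖ ^ p - ‖x‖ ^ p| ≤ (p * (p - 1) * D ^ 2 + 2) * R := by
      have : 0 ≤ p * (p - 1) * D ^ 2 * R := by positivity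
      rw [abs_le]
      constructor <;> linarith
    rw [Kker, if_neg hz.not_ge, min_eq_right hz.le, one_pow, mul_one, sub_zero]
    have e : expBarrier N p θ lam (x + η x t z) t - expBarrier N p θ lam x t =
        s * (‖x + η x t z‖ ^ p - ‖x‖ ^ p) := by
      unfold expBarrier
      ring
    rw [e, abs_mul, abs_of_nonneg hs0]
    gcongr

theorem one_add_norm_rpow_le (hp : 0 ≤ p) (x : Euc N) :
    (1 + ‖x‖) ^ p ≤ 2 ^ p * (‖x‖ ^ p + 1) := by
  have h : (1 + ‖x‖) ^ p ≤ (2 * max ‖x‖ 1) ^ p := by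
    refine Real.rpow_le_rpow (by positivity) ?_ hp
    linarith [le_max_left ‖x‖ 1, le_max_right ‖x‖ 1]
  refine h.trans ?_
  rw [Real.mul_rpow (by norm_num) (by positivity)]
  gcongr
  rcases max_choice ‖x‖ 1 with h | h <;> rw [h]
  · linarith
  · rw [Real.one_rpow]
    linarith [Real.rpow_nonneg (norm_nonneg x) p]

theorem abs_expBarrier_le {t : ℝ} (hθ : 0 ≤ θ) (hlam : 0 ≤ lam) (ht : 0 ≤ t) (x : Euc N) :
    |expBarrier N p θ lam x t| ≤ θ * (1 + ‖x‖ ^ p) := by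
  rw [abs_of_nonneg (expBarrier_nonneg hθ x t), expBarrier, add_comm (‖x‖ ^ p)]
  gcongr
  exact mul_le_of_le_one_right hθ (Real.exp_le_one_iff.2 (by nlinarith))

theorem setIntegral_Kker_expBarrier_le {l : ℕ} {ν : Measure (Euc l)}
    {η : Euc N → ℝ → Euc l → Euc N} {D : ℝ} {x : Euc N} {t : ℝ} {S : Set (Euc l)}
    (hp : 2 < p) (hθ : 0 ≤ θ) (hD : 0 ≤ D) (hη : ∀ z, ‖η x t z‖ ≤ D * min ‖z‖ 1)
    (hν : IntegrableOn (fun z : Euc l => (min ‖z‖ 1) ^ 2) {z | 0 < ‖z‖} ν)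
    (hS : S ⊆ {z | 0 < ‖z‖})
    (hK : IntegrableOn
      (fun z => Kker η x t z (expBarrier N p θ lam) (pd1 (expBarrier N p θ lam) x t)) S ν) :
    ∫ z in S, Kker η x t z (expBarrier N p θ lam) (pd1 (expBarrier N p θ lam) x t) ∂ν ≤
      θ * Real.exp (-(lam * t)) * ((p * (p - 1) * D ^ 2 + 2) * (1 + D) ^ p * (1 + ‖x‖) ^ p) *
        ∫ z in {z : Euc l | 0 < ‖z‖}, (min ‖z‖ 1) ^ 2 ∂ν := by
  have hp1 : 0 ≤ p - 1 := by linarith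
  rw [← integral_const_mul]
  refine (integral_mono hK ((hν.mono_set hS).const_mul _) fun z =>
    (le_abs_self _).trans (abs_Kker_expBarrier_le hp hθ hD (hη z))).trans ?_
  exact setIntegral_mono_set (hν.const_mul _) (ae_of_all _ fun z => by positivity)
    (ae_of_all _ hS)

end Barrier

theorem OperatorAssumptions.exists_jump_bound {N l : ℕ} {T : ℝ}
    {σ : Euc N → ℝ → Matrix (Fin N) (Fin N) ℝ} {a : Euc N → ℝ → Fin N → ℝ}
    {ν : Measure (Euc l)} {η : Euc N → ℝ → Euc l → Euc N}
    (h : OperatorAssumptions N l T σ a ν η) :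
    ∃ D : ℝ, 0 ≤ D ∧ ∀ x t z, ‖η x t z‖ ≤ D * min ‖z‖ 1 := by
  obtain ⟨B, hB, hη⟩ := h.eta_bound
  refine ⟨N * B, by positivity, fun x t z => ?_⟩
  rw [mul_assoc]
  exact norm_le_card_mul_of_abs_apply_le fun k => (hη x x t z k).1

theorem OperatorAssumptions.integrableOn_min_norm_one_sq {N l : ℕ} {T : ℝ}
    {σ : Euc N → ℝ → Matrix (Fin N) (Fin N) ℝ} {a : Euc N → ℝ → Fin N → ℝ}
    {ν : Measure (Euc l)} {η : Euc N → ℝ → Euc l → Euc N}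
    (h : OperatorAssumptions N l T σ a ν η) :
    IntegrableOn (fun z : Euc l => (min ‖z‖ 1) ^ 2) {z | 0 < ‖z‖} ν := by
  obtain ⟨Λ, -, hΛ, -, h1, h2, -⟩ := h.levy
  exact _root_.integrableOn_min_norm_one_sq hΛ h1 h2

/-- The barrier has a nonpositive image under `H^κ`, once `λ` is large. -/
theorem exists_Hkop_expBarrier_nonpos {N l : ℕ} {T : ℝ}
    {σ : Euc N → ℝ → Matrix (Fin N) (Fin N) ℝ} {a : Euc N → ℝ → Fin N → ℝ}
    {ν : Measure (Euc l)} {η : Euc N → ℝ → Euc l → Euc N}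
    (hop : OperatorAssumptions N l T σ a ν η) {p : ℝ} (hp : 2 < p) :
    ∃ lam₀ : ℝ, 0 < lam₀ ∧ ∀ θ : ℝ, 0 ≤ θ → ∀ lam : ℝ, lam₀ ≤ lam → ∀ (x : Euc N),
      ∀ t ∈ Icc 0 T, ∀ κ ∈ Ioo (0 : ℝ) 1,
        IntegrableOn (fun z => Kker η x t z (expBarrier N p θ lam)
          (pd1 (expBarrier N p θ lam) x t)) {z | 0 < ‖z‖ ∧ ‖z‖ < κ} ν ∧
        IntegrableOn (fun z => Kker η x t z (expBarrier N p θ lam)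
          (pd1 (expBarrier N p θ lam) x t)) {z | κ ≤ ‖z‖} ν ∧
        Hkop σ a ν η κ (expBarrier N p θ lam) (expBarrier N p θ lam) x t ≤ 0 := by
  obtain ⟨A, hA, hcoeff⟩ := hop.coeff
  obtain ⟨D, hD, hη⟩ := hop.exists_jump_bound
  have hν := hop.integrableOn_min_norm_one_sq
  have hp1 : 0 ≤ p - 1 := by linarith
  set M := ∫ z in {z : Euc l | 0 < ‖z‖}, (min ‖z‖ 1) ^ 2 ∂ν with hM
  have hM0 : 0 ≤ M := integral_nonneg fun z => by positivity
  set C₁ : ℝ := N ^ 3 * A ^ 2 * (p * (p - 1)) + N * A * p with hC₁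
  set C₂ : ℝ := (p * (p - 1) * D ^ 2 + 2) * (1 + D) ^ p with hC₂
  have hC₁0 : 0 ≤ C₁ := by positivity
  have hC₂0 : 0 ≤ C₂ := by positivity
  refine ⟨2 ^ p * (C₁ + 2 * C₂ * M) + 1, by positivity, fun θ hθ lam hlam x t ht κ hκ => ?_⟩
  have hlam0 : 0 ≤ lam := le_trans (by positivity) hlam
  have hks := integrableOn_Kker_small (contDiff_expBarrier (N := N) (θ := θ) (lam := lam) hp t)
    (hop.eta_meas x t) (hη x t) hD hν hκ.2.le
  have hkl := integrableOn_Kker_large (γ := p)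
    (contDiff_expBarrier (N := N) (θ := θ) (lam := lam) hp t).continuous.measurable hθ
    (by linarith) (abs_expBarrier_le hθ hlam0 ht.1) (hop.eta_meas x t) (hη x t) hD hν hκ.1 hκ.2.le
    (pd1 (expBarrier N p θ lam) x t)
  refine ⟨hks, hkl, ?_⟩
  have h1 : Lop σ a (expBarrier N p θ lam) x t ≤ _ :=
    Lop_expBarrier_le hp hθ (by linarith)
      (fun k m => (le_add_of_nonneg_left (abs_nonneg _)).trans (hcoeff x x t t ht ht k m).2)
      (fun k => (le_add_of_nonneg_right (abs_nonneg _)).trans (hcoeff x x t t ht ht k k).2)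
  have h2 : Ismall ν η κ (expBarrier N p θ lam) (pd1 (expBarrier N p θ lam) x t) x t ≤ _ :=
    setIntegral_Kker_expBarrier_le hp hθ hD (hη x t) hν (fun z hz => hz.1) hks
  have h3 : Ilarge ν η κ (expBarrier N p θ lam) (pd1 (expBarrier N p θ lam) x t) x t ≤ _ :=
    setIntegral_Kker_expBarrier_le hp hθ hD (hη x t) hν (fun z hz => hκ.1.trans_le hz) hkl
  rw [← hC₁] at h1
  rw [← hC₂, ← hM] at h2 h3
  set s := θ * Real.exp (-(lam * t)) with hs
  have hs0 : 0 ≤ s := by positivity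
  have hW : expBarrier N p θ lam x t = s * (‖x‖ ^ p + 1) := rfl
  have h4 : s * ((C₁ + 2 * C₂ * M) * (1 + ‖x‖) ^ p) ≤
      s * ((C₁ + 2 * C₂ * M) * (2 ^ p * (‖x‖ ^ p + 1))) := by
    gcongr
    exact one_add_norm_rpow_le (by linarith) x
  have h5 : 2 ^ p * (C₁ + 2 * C₂ * M) * (s * (‖x‖ ^ p + 1)) ≤ lam * (s * (‖x‖ ^ p + 1)) := by
    gcongr
    linarith
  rw [hW] at h1
  rw [Hkop]
  linarith

theorem LSCp.measurable {N : ℕ} {T : ℝ} {u : Euc N → ℝ → ℝ} (hu : LSCp T u) {t : ℝ}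
    (ht : t ∈ Icc 0 T) : Measurable (fun x => u x t) := by
  have h : LowerSemicontinuousOn (fun x => u x t) univ :=
    hu.1.comp (t := univ) (g := fun x => (x, t)) (by fun_prop) fun x _ => ⟨mem_univ _, ht⟩
  exact (lowerSemicontinuousOn_univ_iff.1 h).measurable

theorem LSCp.add_expBarrier {N : ℕ} {T p θ lam : ℝ} {u : Euc N → ℝ → ℝ} (hu : LSCp T u)
    (hp : 1 ≤ p) (hθ : 0 ≤ θ) (hlam : 0 ≤ lam) :
    LSCp T (fun x t => u x t + expBarrier N p θ lam x t) := by
  obtain ⟨hsc, c, γ, hc, hγ, hb⟩ := hu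
  refine ⟨hsc.add (continuous_expBarrier (by linarith)).continuousOn.lowerSemicontinuousOn,
    2 * (c + θ), max γ p, by linarith, hγ.trans (le_max_left _ _), fun x t ht => ?_⟩
  have key : ∀ q, 0 ≤ q → q ≤ max γ p → 1 + ‖x‖ ^ q ≤ 2 * (1 + ‖x‖ ^ max γ p) := by
    intro q hq hqm
    have h0 : 0 ≤ ‖x‖ ^ max γ p := by positivity
    rcases le_total ‖x‖ 1 with hx | hx
    · linarith [Real.rpow_le_one (norm_nonneg x) hx hq]
    · linarith [Real.rpow_le_rpow_of_exponent_le hx hqm]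
  calc |u x t + expBarrier N p θ lam x t| ≤ c * (1 + ‖x‖ ^ γ) + θ * (1 + ‖x‖ ^ p) :=
        (abs_add_le _ _).trans (add_le_add (hb x t ht) (abs_expBarrier_le hθ hlam ht.1 x))
    _ ≤ c * (2 * (1 + ‖x‖ ^ max γ p)) + θ * (2 * (1 + ‖x‖ ^ max γ p)) := by
        gcongr
        · exact key γ (by linarith) (le_max_left _ _)
        · exact key p (by linarith) (le_max_right _ _)
    _ = _ := by ring

theorem IsC12.sub {N : ℕ} {T : ℝ} {φ w : Euc N → ℝ → ℝ} (hφ : IsC12 T φ) (hw : IsC12 T w) :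
    IsC12 T (fun x t => φ x t - w x t) :=
  ⟨fun t ht => (hφ.1 t ht).sub (hw.1 t ht), fun x t ht => (hφ.2.1 x t ht).sub (hw.2.1 x t ht),
    hφ.2.2.sub hw.2.2⟩

/-- Lemma 3.1 (perturbed supersolution): adding `θ e^{-λt}(|x|^{2γ+2}+1)` to every
component of a viscosity supersolution again yields a viscosity supersolution,
provided `λ ≥ λ₀`, where `λ₀` is independent of `θ`. -/
theorem perturbed_supersolution
    {N l d : ℕ} (T : ℝ)
    (σ : Euc N → ℝ → Matrix (Fin N) (Fin N) ℝ) (a : Euc N → ℝ → Fin N → ℝ)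
    (ν : Measure (Euc l)) (η : Euc N → ℝ → Euc l → Euc N)
    (ψ : Fin d → Euc N → ℝ → ℝ) (c : Fin d → Fin d → Euc N → ℝ → ℝ)
    (g : Fin d → Euc N → ℝ)
    (hop : OperatorAssumptions N l T σ a ν η)
    (hdata : DataAssumptions N d T ψ c g)
    (up : Fin d → Euc N → ℝ → ℝ)
    (hsuper : IsSupersol T σ a ν η ψ c g up) :
    ∀ γ : ℝ, 0 < γ → ∃ lam₀ : ℝ, 0 < lam₀ ∧ ∀ θ : ℝ, 0 ≤ θ → ∀ lam : ℝ, lam₀ ≤ lam →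
      IsSupersol T σ a ν η ψ c g
        (fun i x t => up i x t + θ * Real.exp (-(lam * t)) * (‖x‖ ^ (2*γ+2 : ℝ) + 1)) := by
  intro γ hγ
  have hp : 2 < 2 * γ + 2 := by linarith
  obtain ⟨lam₀, hlam₀, hbar⟩ := exists_Hkop_expBarrier_nonpos hop hp
  obtain ⟨D, hD, hη⟩ := hop.exists_jump_bound
  have hν := hop.integrableOn_min_norm_one_sq
  obtain ⟨hlsc, hterm, hvisc⟩ := hsuper
  refine ⟨lam₀, hlam₀, fun θ hθ lam hlam => ?_⟩
  change IsSupersol T σ a ν η ψ c g (fun i x t => up i x t + expBarrier N (2 * γ + 2) θ lam x t)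
  have hlam0 : 0 ≤ lam := hlam₀.le.trans hlam
  refine ⟨fun i => (hlsc i).add_expBarrier (by linarith) hθ hlam0,
    fun i x => (hterm i x).trans (le_add_of_nonneg_right (expBarrier_nonneg hθ x T)), ?_⟩
  intro i x₀ t₀ ht₀ φ hφ hφeq hmax κ hκ
  have ht : t₀ ∈ Icc 0 T := Ioo_subset_Icc_self ht₀
  have ht' : t₀ ∈ Ico 0 T := Ioo_subset_Ico_self ht₀
  have hw : IsC12 T (expBarrier N (2 * γ + 2) θ lam) := isC12_expBarrier hp T
  set w := expBarrier N (2 * γ + 2) θ lam with hwdef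
  have hφ' : IsC12 T (fun x t => φ x t - w x t) := hφ.sub hw
  obtain ⟨hH, hobs⟩ := hvisc i x₀ t₀ ht₀ _ hφ' (by linarith)
    (fun x t htx => by linarith [hmax x t htx]) κ hκ
  obtain ⟨hws, hwl, hwH⟩ := hbar θ hθ lam hlam x₀ t₀ ht κ hκ
  refine ⟨?_, fun j hj => by linarith [hobs j hj]⟩
  obtain ⟨cu, γu, hcu, hγu, hub⟩ := (hlsc i).2
  have hadd := Hkop_add (σ := σ) (a := a) (φ := fun x t => φ x t - w x t) (hφ'.1 t₀ ht') (hw.1 t₀ ht') (hφ'.2.1 x₀ t₀ ht')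
    (hw.2.1 x₀ t₀ ht')
    (integrableOn_Kker_small (φ := fun x t => φ x t - w x t) (hφ'.1 t₀ ht')
      (hop.eta_meas x₀ t₀) (hη x₀ t₀) hD hν hκ.2.le) hws
    (integrableOn_Kker_large ((hlsc i).measurable ht) (by linarith) (by linarith)
      (fun y => hub y t₀ ht) (hop.eta_meas x₀ t₀) (hη x₀ t₀) hD hν hκ.1 hκ.2.le _) hwl
  simp only [sub_add_cancel] at hadd
  rw [hadd]
  linarith

end
end

section
/- No-loop index selection lemma: Let d ≥ 1 and let a, b : {1,…,d} → ℝ and c : {1,…,d}×{1,…,d} → ℝ satisfy c(i,i) = 0 for all i, and the no-loop condition: for every k ≥ 2 and all pairwise distinct indices i_1,…,i_k ∈ {1,…,d}, c(i_1,i_2) + c(i_2,i_3) + ⋯ + c(i_{k−1},i_k) + c(i_k,i_1) > 0. Suppose that b(i) ≥ b(j) − c(i,j) for all i and all j ≠ i. Let M = max_{i}(a(i) − b(i)) and let 𝕀 = {i : a(i) − b(i) = M}. Then there exists k ∈ 𝕀 such that a(k) > a(j) − c(k,j) for every j ≠ k. -/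
open Set

/-- A fixed-point-free self-map of a nonempty finite type has a cycle of length at least two. -/
theorem exists_injective_cycle {α : Type*} [Finite α] [Nonempty α] (f : α → α)
    (hf : ∀ x, f x ≠ x) :
    ∃ (k : ℕ) (idx : Fin (k + 2) → α), Function.Injective idx ∧
      ∀ m, idx (m + 1) = f (idx m) := by
  obtain ⟨x, hx⟩ : ∃ x, x ∈ Function.periodicPts f := by
    obtain ⟨x₀⟩ := ‹Nonempty α›
    obtain ⟨p, q, hpq, h⟩ := Finite.exists_ne_map_eq_of_infinite fun n : ℕ => f^[n] x₀
    wlog hlt : p < q generalizing p q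
    · exact this q p hpq.symm h.symm (by omega)
    refine ⟨f^[p] x₀, q - p, by omega, ?_⟩
    change f^[q - p] (f^[p] x₀) = f^[p] x₀
    rw [← Function.iterate_add_apply, Nat.sub_add_cancel hlt.le]
    exact h.symm
  have hpos := Function.minimalPeriod_pos_of_mem_periodicPts hx
  have hne : Function.minimalPeriod f x ≠ 1 := fun h =>
    hf x (Function.minimalPeriod_eq_one_iff_isFixedPt.mp h)
  obtain ⟨k, hk⟩ : ∃ k, Function.minimalPeriod f x = k + 2 :=
    ⟨Function.minimalPeriod f x - 2, by omega⟩
  refine ⟨k, fun m => f^[m] x, fun m n h => ?_, fun m => ?_⟩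
  · exact Fin.ext (Function.iterate_injOn_Iio_minimalPeriod
      (by simp [hk]) (by simp [hk]) h)
  · rw [← Function.iterate_succ_apply' f]
    rcases eq_or_ne m (Fin.last (k + 1)) with rfl | hm
    · simpa [hk] using (Function.iterate_minimalPeriod (f := f) (x := x)).symm
    · beta_reduce
      rw [Fin.val_add_one_of_lt (Fin.lt_last_iff_ne_last.mpr hm)]

/-- No-loop index selection lemma: if the switching costs have zero diagonal and
strictly positive loops, and `b` is above its obstacle, then some index `k` in the
argmax set of `a - b` satisfies `a k > a j - c k j` for all `j ≠ k`. -/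
theorem no_loop_index_selection
    (d : ℕ) (hd : 1 ≤ d)
    (a b : Fin d → ℝ) (c : Fin d → Fin d → ℝ)
    (hdiag : ∀ i, c i i = 0)
    (hloop : ∀ (k : ℕ) (idx : Fin (k + 2) → Fin d), Function.Injective idx →
      0 < ∑ m : Fin (k + 2), c (idx m) (idx (m + 1)))
    (hb : ∀ (i : Fin d), ∀ j ≠ i, b j - c i j ≤ b i)
    (M : ℝ) (hM : IsGreatest (Set.range fun i => a i - b i) M) :
    ∃ k : Fin d, a k - b k = M ∧ ∀ j ≠ k, a j - c k j < a k := by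
  by_contra! hcon
  obtain ⟨⟨i₀, hi₀⟩, hmax⟩ := hM
  have hle : ∀ j, a j - b j ≤ M := fun j => hmax ⟨j, rfl⟩
  have hstep : ∀ k : {k // a k - b k = M}, ∃ j : {k // a k - b k = M},
      j ≠ k ∧ c k j = a j - a k := by
    rintro ⟨k, hk⟩
    obtain ⟨j, hjk, hj⟩ := hcon k hk
    have h₁ := hle j
    have h₂ := hb k j hjk
    exact ⟨⟨j, by linarith⟩, fun h => hjk (congrArg Subtype.val h), by dsimp only; linarith⟩
  choose f hne hcost using hstep
  have : Nonempty {k // a k - b k = M} := ⟨⟨i₀, hi₀⟩⟩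
  obtain ⟨k, idx, hinj, hidx⟩ := exists_injective_cycle f hne
  have hsum := hloop k (fun m => idx m) (Subtype.val_injective.comp hinj)
  have hshift : ∑ m, a (idx (m + 1)) = ∑ m, a (idx m) :=
    Equiv.sum_comp (Equiv.addRight (1 : Fin (k + 2))) fun m => a (idx m)
  have hzero : ∑ m, c (idx m) (idx (m + 1)) = 0 := by
    rw [Finset.sum_congr rfl fun m _ => by rw [hidx m, hcost, ← hidx m],
      Finset.sum_sub_distrib, hshift, sub_self]
  exact hsum.ne' hzero
end

section
/- Convergence of doubled-variable penalized maximizers: Let T > 0, R > 0, θ > 0, β > 0, Λ > 0, γ ≥ 1/2. Let u be upper semicontinuous and v lower semicontinuous, both real-valued on the closed ball B̄(0,R)×[0,T] ⊂ ℝ^N×[0,T]. Suppose (x̄,t̄) ∈ B(0,R)×(0,T) satisfies u(x̄,t̄) − v(x̄,t̄) − θ/t̄ = sup{u(x,t) − v(x,t) − θ/t : (x,t) ∈ B̄(0,R)×(0,T]}. For ε > 0 define φ_ε(x,y,t) = (1/(2ε))|x−y|² + Λ(|x−x̄|^{2γ+2} + |y−x̄|^{2γ+2}) + β(t−t̄)²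 and Φ_ε(x,y,t) = u(x,t) − v(y,t) − θ/t − φ_ε(x,y,t). Then: (a) for every ε > 0, Φ_ε attains its supremum over B̄(0,R)×B̄(0,R)×(0,T] at some point (x_ε,y_ε,t_ε); (b) for any choice of such maximizers, as ε → 0 one has (x_ε,y_ε,t_ε) → (x̄,x̄,t̄) (in particular t_ε ∈ (0,T) for all sufficiently small ε), u(x_ε,t_ε) → u(x̄,t̄), v(y_ε,t_ε) → v(x̄,t̄), φ_ε(x_ε,y_ε,t_ε) → 0, and in particular (1/ε)|x_ε − y_ε|² → 0. -/
open Set Filter Metric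
open scoped Topology

noncomputable section

/-- The penalty function
`φ_ε(x,y,t) = |x-y|²/(2ε) + Λ(|x-x̄|^{2γ+2} + |y-x̄|^{2γ+2}) + β(t-t̄)²`. -/
noncomputable def phiPen {N : ℕ} (ε Λ β γ : ℝ) (xb : Euc N) (tb : ℝ)
    (x y : Euc N) (t : ℝ) : ℝ :=
  (1/(2*ε)) * ‖x - y‖ ^ 2 + Λ * (‖x - xb‖ ^ (2*γ+2 : ℝ) + ‖y - xb‖ ^ (2*γ+2 : ℝ))
    + β * (t - tb) ^ 2

/-- The doubled and penalized function `Φ_ε(x,y,t) = u(x,t) - v(y,t) - θ/t - φ_ε(x,y,t)`. -/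
noncomputable def PhiPen {N : ℕ} (u v : Euc N → ℝ → ℝ) (θ ε Λ β γ : ℝ) (xb : Euc N) (tb : ℝ)
    (x y : Euc N) (t : ℝ) : ℝ :=
  u x t - v y t - θ / t - phiPen ε Λ β γ xb tb x y t

/-- A maximizer of `Φ_ε` over `B̄(0,R) × B̄(0,R) × (0,T]`. -/
def IsPenMax {N : ℕ} (R T : ℝ) (u v : Euc N → ℝ → ℝ) (θ ε Λ β γ : ℝ) (xb : Euc N) (tb : ℝ)
    (xe ye : Euc N) (te : ℝ) : Prop :=
  xe ∈ closedBall (0 : Euc N) R ∧ ye ∈ closedBall (0 : Euc N) R ∧ te ∈ Ioc (0:ℝ) T ∧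
  ∀ x ∈ closedBall (0 : Euc N) R, ∀ y ∈ closedBall (0 : Euc N) R, ∀ t ∈ Ioc (0:ℝ) T,
    PhiPen u v θ ε Λ β γ xb tb x y t ≤ PhiPen u v θ ε Λ β γ xb tb xe ye te

section Penalization

variable {N : ℕ} {T R θ β Λ γ ε : ℝ} {u v : Euc N → ℝ → ℝ} {xb : Euc N} {tb : ℝ}

lemma phiPen_nonneg (hβ : 0 ≤ β) (hΛ : 0 ≤ Λ) (hε : 0 ≤ ε) (x y : Euc N) (t : ℝ) :
    0 ≤ phiPen ε Λ β γ xb tb x y t := by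
  unfold phiPen
  positivity

lemma phiPen_antitone (hε : 0 < ε) {ε' : ℝ} (h : ε ≤ ε') (x y : Euc N) (t : ℝ) :
    phiPen ε' Λ β γ xb tb x y t ≤ phiPen ε Λ β γ xb tb x y t := by
  unfold phiPen
  gcongr

lemma inv_mul_norm_sq_le_two_mul_phiPen (hβ : 0 ≤ β) (hΛ : 0 ≤ Λ) (x y : Euc N) (t : ℝ) :
    (1 / ε) * ‖x - y‖ ^ 2 ≤ 2 * phiPen ε Λ β γ xb tb x y t := by
  have h₁ : 0 ≤ Λ * (‖x - xb‖ ^ (2*γ+2 : ℝ) + ‖y - xb‖ ^ (2*γ+2 : ℝ)) := by positivity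
  have h₂ : 0 ≤ β * (t - tb) ^ 2 := by positivity
  have h₃ : (1 / ε) * ‖x - y‖ ^ 2 = 2 * ((1 / (2 * ε)) * ‖x - y‖ ^ 2) := by
    rw [one_div, one_div, mul_inv]; ring
  rw [h₃]
  unfold phiPen
  linarith

lemma phiPen_center (hγ : 2 * γ + 2 ≠ 0) : phiPen ε Λ β γ xb tb xb xb tb = 0 := by
  simp [phiPen, Real.zero_rpow hγ]

lemma eq_center_of_phiPen_self_nonpos (hβ : 0 < β) (hΛ : 0 < Λ) (hγ : 2 * γ + 2 ≠ 0)
    {x : Euc N} {t : ℝ} (h : phiPen ε Λ β γ xb tb x x t ≤ 0) : x = xb ∧ t = tb := by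
  have hx : 0 ≤ ‖x - xb‖ ^ (2*γ+2 : ℝ) := by positivity
  have ht : 0 ≤ (t - tb) ^ 2 := sq_nonneg _
  simp only [phiPen, sub_self, norm_zero, ne_eq, OfNat.ofNat_ne_zero, not_false_eq_true,
    zero_pow, mul_zero, zero_add] at h
  have hx' : ‖x - xb‖ ^ (2*γ+2 : ℝ) = 0 := by nlinarith [mul_nonneg hβ.le ht]
  have ht' : (t - tb) ^ 2 = 0 := by nlinarith [mul_nonneg hΛ.le hx]
  rw [Real.rpow_eq_zero (norm_nonneg _) hγ, norm_eq_zero, sub_eq_zero] at hx'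
  exact ⟨hx', sub_eq_zero.mp (pow_eq_zero_iff two_ne_zero |>.mp ht')⟩

lemma continuous_phiPen (hγ : 0 ≤ 2 * γ + 2) :
    Continuous fun q : Euc N × Euc N × ℝ => phiPen ε Λ β γ xb tb q.1 q.2.1 q.2.2 := by
  have h₁ : Continuous fun q : Euc N × Euc N × ℝ => ‖q.1 - xb‖ ^ (2*γ+2 : ℝ) :=
    Continuous.rpow_const (by fun_prop) fun _ => Or.inr hγ
  have h₂ : Continuous fun q : Euc N × Euc N × ℝ => ‖q.2.1 - xb‖ ^ (2*γ+2 : ℝ) :=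
    Continuous.rpow_const (by fun_prop) fun _ => Or.inr hγ
  unfold phiPen
  fun_prop

lemma upperSemicontinuousOn_PhiPen
    (hu : UpperSemicontinuousOn (fun p : Euc N × ℝ => u p.1 p.2)
      (closedBall (0 : Euc N) R ×ˢ Icc 0 T))
    (hv : LowerSemicontinuousOn (fun p : Euc N × ℝ => v p.1 p.2)
      (closedBall (0 : Euc N) R ×ˢ Icc 0 T))
    (hγ : 0 ≤ 2 * γ + 2) {δ : ℝ} (hδ : 0 < δ) :
    UpperSemicontinuousOn
      (fun q : Euc N × Euc N × ℝ => PhiPen u v θ ε Λ β γ xb tb q.1 q.2.1 q.2.2)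
      (closedBall (0 : Euc N) R ×ˢ closedBall (0 : Euc N) R ×ˢ Icc δ T) := by
  set K := closedBall (0 : Euc N) R ×ˢ closedBall (0 : Euc N) R ×ˢ Icc δ T
  have h₁ : UpperSemicontinuousOn (fun q : Euc N × Euc N × ℝ => u q.1 q.2.2) K :=
    hu.comp (g := fun q : Euc N × Euc N × ℝ => (q.1, q.2.2)) (by fun_prop)
      fun q hq => ⟨hq.1, hδ.le.trans hq.2.2.1, hq.2.2.2⟩
  have h₂ : UpperSemicontinuousOn (fun q : Euc N × Euc N × ℝ => -v q.2.1 q.2.2) K := by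
    intro q hq y hy
    have h := hv.comp (g := fun q : Euc N × Euc N × ℝ => q.2) (t := K) (by fun_prop)
      (fun q hq => ⟨hq.2.1, hδ.le.trans hq.2.2.1, hq.2.2.2⟩) q hq (-y) (neg_lt.mp hy)
    exact h.mono fun z hz => neg_lt.mp hz
  have h₃ : ContinuousOn (fun q : Euc N × Euc N × ℝ =>
      -(θ / q.2.2) - phiPen ε Λ β γ xb tb q.1 q.2.1 q.2.2) K :=
    ((continuousOn_const.div (by fun_prop) fun q hq => (hδ.trans_le hq.2.2.1).ne').neg).sub
      (continuous_phiPen hγ).continuousOn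
  have h₄ := (h₁.add h₂).add h₃.upperSemicontinuousOn
  have h₅ : (fun q : Euc N × Euc N × ℝ => PhiPen u v θ ε Λ β γ xb tb q.1 q.2.1 q.2.2) =
      fun q => u q.1 q.2.2 + -v q.2.1 q.2.2 +
        (-(θ / q.2.2) - phiPen ε Λ β γ xb tb q.1 q.2.1 q.2.2) := by
    funext q
    simp only [PhiPen]
    ring
  rwa [h₅]

/-- The singular term `θ/t` keeps the points where `Φ_ε` is above a given level away from `t = 0`,
uniformly in `ε`. -/
lemma exists_pos_le_of_le_PhiPen
    (hu : UpperSemicontinuousOn (fun p : Euc N × ℝ => u p.1 p.2)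
      (closedBall (0 : Euc N) R ×ˢ Icc 0 T))
    (hv : LowerSemicontinuousOn (fun p : Euc N × ℝ => v p.1 p.2)
      (closedBall (0 : Euc N) R ×ˢ Icc 0 T))
    (hθ : 0 < θ) (hβ : 0 ≤ β) (hΛ : 0 ≤ Λ) (S : ℝ) :
    ∃ δ > 0, ∀ ε > 0, ∀ x ∈ closedBall (0 : Euc N) R, ∀ y ∈ closedBall (0 : Euc N) R,
      ∀ t ∈ Ioc 0 T, S ≤ PhiPen u v θ ε Λ β γ xb tb x y t → δ ≤ t := by
  have hK : IsCompact (closedBall (0 : Euc N) R ×ˢ Icc 0 T) :=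
    (isCompact_closedBall _ _).prod isCompact_Icc
  obtain ⟨M, hM⟩ := hu.bddAbove_of_isCompact hK
  obtain ⟨m, hm⟩ := hv.bddBelow_of_isCompact hK
  refine ⟨θ / (|M - m - S| + 1), by positivity, fun ε hε x hx y hy t ht h => ?_⟩
  have hux : u x t ≤ M := hM ⟨(x, t), ⟨hx, ht.1.le, ht.2⟩, rfl⟩
  have hvy : m ≤ v y t := hm ⟨(y, t), ⟨hy, ht.1.le, ht.2⟩, rfl⟩
  have hφ := phiPen_nonneg (γ := γ) (xb := xb) (tb := tb) hβ hΛ hε.le x y t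
  unfold PhiPen at h
  rw [div_le_comm₀ (by positivity) ht.1]
  linarith [le_abs_self (M - m - S)]

lemma eq_center_of_forall_le_PhiPen (hβ : 0 < β) (hΛ : 0 < Λ) (hγ : 2 * γ + 2 ≠ 0)
    (hmax : ∀ x ∈ closedBall (0 : Euc N) R, ∀ t ∈ Ioc (0:ℝ) T,
      u x t - v x t - θ / t ≤ u xb tb - v xb tb - θ / tb)
    {x y : Euc N} {t : ℝ} (hx : x ∈ closedBall (0 : Euc N) R) (ht : t ∈ Ioc 0 T)
    (h : ∀ ε > 0, u xb tb - v xb tb - θ / tb ≤ PhiPen u v θ ε Λ β γ xb tb x y t) :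
    x = xb ∧ y = xb ∧ t = tb := by
  simp only [PhiPen] at h
  set C := u x t - v y t - θ / t - (u xb tb - v xb tb - θ / tb)
  have hxy : x = y := by
    have hle : ∀ ε > 0, ‖x - y‖ ^ 2 ≤ 2 * C * ε := fun ε hε => by
      have h₁ := inv_mul_norm_sq_le_two_mul_phiPen (ε := ε) (γ := γ) (xb := xb) (tb := tb)
        hβ.le hΛ.le x y t
      have h₂ : 1 / ε * ‖x - y‖ ^ 2 ≤ 2 * C := by linarith [h ε hε]
      rwa [one_div_mul_eq_div, div_le_iff₀ hε] at h₂
    have hlim : Tendsto (fun ε : ℝ => 2 * C * ε) (𝓝[>] 0) (𝓝 0) := by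
      have : Continuous fun ε : ℝ => 2 * C * ε := by fun_prop
      simpa using (this.tendsto 0).mono_left nhdsWithin_le_nhds
    have h₀ : ‖x - y‖ ^ 2 ≤ 0 :=
      ge_of_tendsto hlim (eventually_mem_nhdsWithin.mono fun ε hε => hle ε hε)
    exact sub_eq_zero.mp (norm_eq_zero.mp (pow_eq_zero_iff two_ne_zero |>.mp
      (h₀.antisymm (sq_nonneg _))))
  subst hxy
  obtain ⟨rfl, rfl⟩ := eq_center_of_phiPen_self_nonpos (ε := 1) hβ hΛ hγ
    (by linarith [h 1 one_pos, hmax x hx t ht] : phiPen 1 Λ β γ xb tb x x t ≤ 0)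
  exact ⟨rfl, rfl, rfl⟩

end Penalization

/-- If `a - b - c` dominates its expected limit plus a nonnegative error, where `a` is
asymptotically at most `a₀`, `b` is asymptotically at least `b₀` and `c → c₀`, then all the
terms converge. -/
lemma tendsto_of_add_le_sub {ι : Type*} {l : Filter ι} {a b c e : ι → ℝ} {a₀ b₀ c₀ : ℝ}
    (ha : ∀ r > a₀, ∀ᶠ i in l, a i < r) (hb : ∀ r < b₀, ∀ᶠ i in l, r < b i)
    (hc : Tendsto c l (𝓝 c₀)) (he : ∀ᶠ i in l, 0 ≤ e i)
    (h : ∀ᶠ i in l, a₀ - b₀ - c₀ + e i ≤ a i - b i - c i) :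
    Tendsto a l (𝓝 a₀) ∧ Tendsto b l (𝓝 b₀) ∧ Tendsto e l (𝓝 0) := by
  have key : ∀ η > 0, ∀ᶠ i in l, |a i - a₀| < η ∧ |b i - b₀| < η ∧ |e i - 0| < η := by
    intro η hη
    filter_upwards [ha (a₀ + η / 3) (by linarith), hb (b₀ - η / 3) (by linarith),
      hc.eventually (lt_mem_nhds (show c₀ - η / 3 < c₀ by linarith)), he, h] with i h₁ h₂ h₃ h₄ h₅
    simp only [abs_lt]
    refine ⟨⟨?_, ?_⟩, ⟨?_, ?_⟩, ?_, ?_⟩ <;> linarith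
  simp only [Metric.tendsto_nhds, Real.dist_eq]
  exact ⟨fun η hη => (key η hη).mono fun _ h => h.1, fun η hη => (key η hη).mono fun _ h => h.2.1,
    fun η hη => (key η hη).mono fun _ h => h.2.2⟩

/-- Convergence of doubled-variable penalized maximizers: maximizers of `Φ_ε` exist, and
any family of maximizers converges to `(x̄, x̄, t̄)` with convergence of the values of `u`
and `v`, vanishing penalty, and `|x_ε - y_ε|²/ε → 0`, as `ε → 0⁺`. -/
theorem doubled_penalized_maximizers
    {N : ℕ} (T R θ β Λ γ : ℝ)
    (hT : 0 < T) (hR : 0 < R) (hθ : 0 < θ) (hβ : 0 < β) (hΛ : 0 < Λ) (hγ : (1:ℝ)/2 ≤ γ)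
    (u v : Euc N → ℝ → ℝ)
    (hu : UpperSemicontinuousOn (fun p : Euc N × ℝ => u p.1 p.2)
      (closedBall (0 : Euc N) R ×ˢ Icc 0 T))
    (hv : LowerSemicontinuousOn (fun p : Euc N × ℝ => v p.1 p.2)
      (closedBall (0 : Euc N) R ×ˢ Icc 0 T))
    (xb : Euc N) (tb : ℝ) (hxb : xb ∈ ball (0 : Euc N) R) (htb : tb ∈ Ioo (0:ℝ) T)
    (hmax : ∀ x ∈ closedBall (0 : Euc N) R, ∀ t ∈ Ioc (0:ℝ) T,
      u x t - v x t - θ / t ≤ u xb tb - v xb tb - θ / tb) :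
    -- (a) existence of maximizers for every ε > 0
    (∀ ε > (0:ℝ), ∃ (xe ye : Euc N) (te : ℝ), IsPenMax R T u v θ ε Λ β γ xb tb xe ye te) ∧
    -- (b) convergence of any family of maximizers as ε → 0⁺
    (∀ (X Y : ℝ → Euc N) (τ : ℝ → ℝ),
      (∀ ε > (0:ℝ), IsPenMax R T u v θ ε Λ β γ xb tb (X ε) (Y ε) (τ ε)) →
      Tendsto X (𝓝[>] (0:ℝ)) (𝓝 xb) ∧
      Tendsto Y (𝓝[>] (0:ℝ)) (𝓝 xb) ∧
      Tendsto τ (𝓝[>] (0:ℝ)) (𝓝 tb) ∧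
      (∀ᶠ ε in 𝓝[>] (0:ℝ), τ ε ∈ Ioo (0:ℝ) T) ∧
      Tendsto (fun ε => u (X ε) (τ ε)) (𝓝[>] (0:ℝ)) (𝓝 (u xb tb)) ∧
      Tendsto (fun ε => v (Y ε) (τ ε)) (𝓝[>] (0:ℝ)) (𝓝 (v xb tb)) ∧
      Tendsto (fun ε => phiPen ε Λ β γ xb tb (X ε) (Y ε) (τ ε)) (𝓝[>] (0:ℝ)) (𝓝 0) ∧
      Tendsto (fun ε => (1/ε) * ‖X ε - Y ε‖ ^ 2) (𝓝[>] (0:ℝ)) (𝓝 0)) := by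
  have hγ₀ : 0 < 2 * γ + 2 := by linarith
  have hxb' : xb ∈ closedBall (0 : Euc N) R := ball_subset_closedBall hxb
  have htb' : tb ∈ Ioc 0 T := ⟨htb.1, htb.2.le⟩
  set S := u xb tb - v xb tb - θ / tb
  have hcenter : ∀ ε, PhiPen u v θ ε Λ β γ xb tb xb xb tb = S := fun ε => by
    rw [PhiPen, phiPen_center hγ₀.ne', sub_zero]
  obtain ⟨δ, hδ, hlow⟩ := exists_pos_le_of_le_PhiPen (γ := γ) (xb := xb) (tb := tb)
    hu hv hθ hβ.le hΛ.le S
  set K := closedBall (0 : Euc N) R ×ˢ closedBall (0 : Euc N) R ×ˢ Icc δ T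
  have hK : IsCompact K :=
    (isCompact_closedBall _ _).prod ((isCompact_closedBall _ _).prod isCompact_Icc)
  have husc : ∀ ε, UpperSemicontinuousOn
      (fun q : Euc N × Euc N × ℝ => PhiPen u v θ ε Λ β γ xb tb q.1 q.2.1 q.2.2) K :=
    fun ε => upperSemicontinuousOn_PhiPen hu hv hγ₀.le hδ
  have hδtb : δ ≤ tb := hlow 1 one_pos xb hxb' xb hxb' tb htb' (hcenter 1).ge
  have hcK : (xb, xb, tb) ∈ K := ⟨hxb', hxb', hδtb, htb.2.le⟩
  refine ⟨fun ε hε => ?_, fun X Y τ hpen => ?_⟩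
  · obtain ⟨⟨x, y, t⟩, ⟨hx, hy, ht⟩, hq⟩ := (husc ε).exists_isMaxOn ⟨_, hcK⟩ hK
    refine ⟨x, y, t, hx, hy, ⟨hδ.trans_le ht.1, ht.2⟩, fun x' hx' y' hy' t' ht' => ?_⟩
    by_cases hS' : S ≤ PhiPen u v θ ε Λ β γ xb tb x' y' t'
    · exact hq (show (x', y', t') ∈ K from
        ⟨hx', hy', hlow ε hε x' hx' y' hy' t' ht' hS', ht'.2⟩)
    · exact (not_le.mp hS').le.trans ((hcenter ε).ge.trans (hq hcK))
  have hval : ∀ ε > 0, S ≤ PhiPen u v θ ε Λ β γ xb tb (X ε) (Y ε) (τ ε) := fun ε hε =>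
    (hcenter ε).ge.trans ((hpen ε hε).2.2.2 xb hxb' xb hxb' tb htb')
  have hmem : ∀ ε > 0, (X ε, Y ε, τ ε) ∈ K := fun ε hε => by
    obtain ⟨hx, hy, ht, -⟩ := hpen ε hε
    exact ⟨hx, hy, hlow ε hε _ hx _ hy _ ht (hval ε hε), ht.2⟩
  have hpos : ∀ᶠ ε in 𝓝[>] (0:ℝ), 0 < ε := eventually_mem_nhdsWithin
  have hlim : Tendsto (fun ε => (X ε, Y ε, τ ε)) (𝓝[>] (0:ℝ)) (𝓝 (xb, xb, tb)) := by
    refine hK.tendsto_nhds_of_unique_mapClusterPt (hpos.mono hmem) ?_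
    rintro ⟨x, y, t⟩ hq hcl
    obtain ⟨h₁, h₂, h₃⟩ := eq_center_of_forall_le_PhiPen hβ hΛ hγ₀.ne' hmax hq.1
      ⟨hδ.trans_le hq.2.2.1, hq.2.2.2⟩ (fun ε₀ hε₀ => by
        by_contra! hlt
        have hev := eventually_nhdsWithin_iff.mp (husc ε₀ _ hq S hlt)
        have hlt₀ : ∀ᶠ ε in 𝓝[>] (0:ℝ), ε < ε₀ :=
          nhdsWithin_le_nhds (gt_mem_nhds hε₀)
        obtain ⟨ε, h₁, h₂, h₃⟩ :=
          ((hcl.frequently hev).and_eventually (hpos.and hlt₀)).exists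
        have h₄ := h₁ (hmem ε h₂)
        have h₅ := hval ε h₂
        have h₆ := phiPen_antitone (Λ := Λ) (β := β) (γ := γ) (xb := xb) (tb := tb) h₂ h₃.le
          (X ε) (Y ε) (τ ε)
        simp only [PhiPen] at h₄ h₅
        linarith)
    exact Prod.ext h₁ (Prod.ext h₂ h₃)
  have hX : Tendsto X (𝓝[>] (0:ℝ)) (𝓝 xb) := hlim.fst_nhds
  have hY : Tendsto Y (𝓝[>] (0:ℝ)) (𝓝 xb) := hlim.snd_nhds.fst_nhds
  have hτ : Tendsto τ (𝓝[>] (0:ℝ)) (𝓝 tb) := hlim.snd_nhds.snd_nhds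
  have hcD : (xb, tb) ∈ closedBall (0 : Euc N) R ×ˢ Icc 0 T := ⟨hxb', htb.1.le, htb.2.le⟩
  have hXτ : Tendsto (fun ε => (X ε, τ ε)) (𝓝[>] (0:ℝ))
      (𝓝[closedBall (0 : Euc N) R ×ˢ Icc 0 T] (xb, tb)) :=
    tendsto_nhdsWithin_iff.mpr ⟨hX.prodMk_nhds hτ, hpos.mono fun ε hε =>
      ⟨(hmem ε hε).1, hδ.le.trans (hmem ε hε).2.2.1, (hmem ε hε).2.2.2⟩⟩
  have hYτ : Tendsto (fun ε => (Y ε, τ ε)) (𝓝[>] (0:ℝ))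
      (𝓝[closedBall (0 : Euc N) R ×ˢ Icc 0 T] (xb, tb)) :=
    tendsto_nhdsWithin_iff.mpr ⟨hY.prodMk_nhds hτ, hpos.mono fun ε hε =>
      ⟨(hmem ε hε).2.1, hδ.le.trans (hmem ε hε).2.2.1, (hmem ε hε).2.2.2⟩⟩
  obtain ⟨hua, hvb, hφ⟩ := tendsto_of_add_le_sub
    (a := fun ε => u (X ε) (τ ε)) (b := fun ε => v (Y ε) (τ ε)) (c := fun ε => θ / τ ε)
    (fun r hr => hXτ.eventually (hu _ hcD r hr)) (fun r hr => hYτ.eventually (hv _ hcD r hr))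
    (tendsto_const_nhds.div hτ htb.1.ne')
    (hpos.mono fun ε hε => phiPen_nonneg (γ := γ) (xb := xb) (tb := tb) hβ.le hΛ.le hε.le
      (X ε) (Y ε) (τ ε))
    (hpos.mono fun ε hε => by
      have := hval ε hε
      simp only [PhiPen] at this
      linarith)
  refine ⟨hX, hY, hτ, hτ.eventually (isOpen_Ioo.mem_nhds htb), hua, hvb, hφ, ?_⟩
  refine squeeze_zero' (hpos.mono fun ε hε => by positivity)
    (Eventually.of_forall fun ε =>
      inv_mul_norm_sq_le_two_mul_phiPen (γ := γ) (xb := xb) (tb := tb) hβ.le hΛ.le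
        (X ε) (Y ε) (τ ε)) ?_
  simpa using hφ.const_mul 2

end
end

section
/- Jump increment estimate for the penalty function: Let γ > 0, ε > 0, Λ > 0, β ≥ 0, T > 0, x̄ ∈ ℝ^N, t̄ ∈ ℝ, and define φ_ε(x,y,t) = (1/(2ε))|x−y|² + Λ(|x−x̄|^{2γ+2} + |y−x̄|^{2γ+2}) + β(t−t̄)². Let B̂ ≥ 1, z ∈ ℝ^l∖{0}, and let η_x, η_y ∈ ℝ^N satisfy |η_x| ≤ B̂ min{|z|,1}, |η_y| ≤ B̂ min{|z|,1} and |η_x − η_y| ≤ B̂ min{|z|,1}|x − y|. Then there is a constant c ≥ 1 depending only on N, B̂ and γ such that for all x, y ∈ ℝ^N and t ∈ ℝ: φ_ε(x+η_x, y+η_y, t) − φ_ε(x,y,t) − ⟨η_x, D_xφ_ε(x,y,t)⟩ − ⟨η_y, D_yφ_ε(x,y,t)⟩ ≤ (1/(2ε))|η_x − η_y|² + cΛ min{|z|,1}²(1 + |x−x̄|^{2γ+2} + |y−x̄|^{2γ+2}) ≤ c·min{|z|,1}²·[ (1/ε)|x−y|² + Λ(1 + |x−x̄|^{2γ+2} +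 |y−x̄|^{2γ+2}) ]. -/
open Set
open scoped RealInnerProductSpace

noncomputable section

/-- The gradient of `φ_ε` in the `x`-variable:
`D_xφ_ε(x,y,t) = (x-y)/ε + Λ(2γ+2)(x-x̄)|x-x̄|^{2γ}`. -/
noncomputable def DxPen {N : ℕ} (ε Λ γ : ℝ) (xb : Euc N) (x y : Euc N) : Euc N :=
  (1/ε) • (x - y) + (Λ * (2*γ+2) * ‖x - xb‖ ^ (2*γ : ℝ)) • (x - xb)

/-- The gradient of `φ_ε` in the `y`-variable:
`D_yφ_ε(x,y,t) = -(x-y)/ε + Λ(2γ+2)(y-x̄)|y-x̄|^{2γ}`. -/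
noncomputable def DyPen {N : ℕ} (ε Λ γ : ℝ) (xb : Euc N) (x y : Euc N) : Euc N :=
  -((1/ε) • (x - y)) + (Λ * (2*γ+2) * ‖y - xb‖ ^ (2*γ : ℝ)) • (y - xb)

theorem one_sub_rpow_le {x s : ℝ} (hs : 0 ≤ s) (hx : 0 ≤ x) (hx1 : x ≤ 1) :
    1 - x ^ s ≤ (1 + s) * (1 - x) := by
  rcases le_total 1 s with h | h
  · have := one_add_mul_self_le_rpow_one_add (s := x - 1) (by linarith) h
    rw [add_sub_cancel] at this
    nlinarith
  · rcases hx.eq_or_lt with rfl | h0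
    · have := Real.zero_rpow_nonneg s
      linarith
    · have := Real.rpow_le_rpow_of_exponent_ge h0 hx1 h
      rw [Real.rpow_one] at this
      nlinarith

/-- The gradient inequality for the convex function `v ↦ v ^ ((s + 2) / 2)`, evaluated at squares. -/
theorem rpow_add_two_sub_le {R r s : ℝ} (hs : 0 < s) (hR : 0 ≤ R) (hr : 0 ≤ r) :
    R ^ (s + 2) - r ^ (s + 2) ≤ (s + 2) / 2 * (R ^ s * (R ^ 2 - r ^ 2)) := by
  rcases hR.eq_or_lt with rfl | h0
  · rw [Real.zero_rpow (by linarith), Real.zero_rpow hs.ne']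
    have := Real.rpow_nonneg hr (s + 2)
    linarith
  · have hB := one_add_mul_self_le_rpow_one_add (s := (r / R) ^ 2 - 1) (p := (s + 2) / 2)
      (by nlinarith [sq_nonneg (r / R)]) (by linarith)
    rw [add_sub_cancel, ← Real.rpow_natCast (r / R), ← Real.rpow_mul (by positivity)] at hB
    have he : ((2 : ℕ) : ℝ) * ((s + 2) / 2) = s + 2 := by push_cast; ring
    rw [he, Real.div_rpow hr hR (s + 2), Real.rpow_natCast] at hB
    have hp : 0 < R ^ (s + 2) := Real.rpow_pos_of_pos h0 _
    have hm := mul_le_mul_of_nonneg_left hB hp.le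
    have hR2 : R ^ (s + 2) = R ^ s * R ^ 2 := by
      rw [Real.rpow_add h0, Real.rpow_two]
    have e1 : R ^ (s + 2) * (r ^ (s + 2) / R ^ (s + 2)) = r ^ (s + 2) := by
      field_simp
    have e2 : R ^ (s + 2) * (1 + (s + 2) / 2 * ((r / R) ^ 2 - 1))
        = R ^ (s + 2) - (s + 2) / 2 * (R ^ s * (R ^ 2 - r ^ 2)) := by
      rw [hR2]
      field_simp
      ring
    linarith

theorem rpow_sub_mul_sq_sub_le {R r s : ℝ} (hs : 0 ≤ s) (hr : 0 ≤ r) (h : r ≤ R) :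
    (R ^ s - r ^ s) * (R ^ 2 - r ^ 2) ≤ 2 * (1 + s) * R ^ s * (R - r) ^ 2 := by
  rcases (hr.trans h).eq_or_lt with rfl | h0
  · obtain rfl : r = 0 := le_antisymm h hr
    simp
  · have h1 := one_sub_rpow_le hs (div_nonneg hr h0.le) ((div_le_one h0).2 h)
    rw [Real.div_rpow hr h0.le] at h1
    have hp : 0 < R ^ s := Real.rpow_pos_of_pos h0 _
    have h2 : (R ^ s - r ^ s) * R ≤ (1 + s) * R ^ s * (R - r) := by
      have := mul_le_mul_of_nonneg_left h1 (mul_pos hp h0).le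
      have e1 : R ^ s * R * (1 - r ^ s / R ^ s) = (R ^ s - r ^ s) * R := by field_simp
      have e2 : R ^ s * R * ((1 + s) * (1 - r / R)) = (1 + s) * R ^ s * (R - r) := by field_simp
      linarith
    have h3 : 0 ≤ R ^ s - r ^ s := sub_nonneg.2 (Real.rpow_le_rpow hr h hs)
    have h4 : 0 ≤ R - r := sub_nonneg.2 h
    calc (R ^ s - r ^ s) * (R ^ 2 - r ^ 2) = (R ^ s - r ^ s) * (R + r) * (R - r) := by ring
      _ ≤ (R ^ s - r ^ s) * (2 * R) * (R - r) := by gcongr; linarith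
      _ = 2 * ((R ^ s - r ^ s) * R) * (R - r) := by ring
      _ ≤ 2 * ((1 + s) * R ^ s * (R - r)) * (R - r) := by gcongr
      _ = _ := by ring

theorem rpow_le_one_add_rpow_add_two {r s : ℝ} (hs : 0 ≤ s) (hr : 0 ≤ r) :
    r ^ s ≤ 1 + r ^ (s + 2) := by
  rcases le_total r 1 with h | h
  · have := Real.rpow_le_one hr h hs
    have := Real.rpow_nonneg hr (s + 2)
    linarith
  · have := Real.rpow_le_rpow_of_exponent_le h (show s ≤ s + 2 by linarith)
    linarith

theorem add_rpow_le {r s B : ℝ} (hs : 0 ≤ s) (hr : 0 ≤ r) (hB : 0 ≤ B) :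
    (r + B) ^ s ≤ (1 + B) ^ s * (1 + r ^ (s + 2)) := by
  have hp := Real.rpow_nonneg hr (s + 2)
  have hq := Real.rpow_nonneg (show 0 ≤ 1 + B by linarith) s
  rcases le_total r 1 with h | h
  · calc (r + B) ^ s ≤ (1 + B) ^ s := by gcongr
      _ ≤ _ := le_mul_of_one_le_right hq (by linarith)
  · calc (r + B) ^ s ≤ ((1 + B) * r) ^ s := by gcongr; nlinarith
      _ = (1 + B) ^ s * r ^ s := Real.mul_rpow (by linarith) hr
      _ ≤ _ := by gcongr; exact rpow_le_one_add_rpow_add_two hs hr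

/-- Second-order estimate for the increment of `u ↦ ‖u‖ ^ (s + 2)`. -/
theorem norm_add_rpow_sub_le {E : Type*} [NormedAddCommGroup E] [InnerProductSpace ℝ E]
    {s B : ℝ} (hs : 0 < s) {u η : E} (hη : ‖η‖ ≤ B) :
    ‖u + η‖ ^ (s + 2) - ‖u‖ ^ (s + 2) - (s + 2) * ‖u‖ ^ s * ⟪η, u⟫
      ≤ (s + 2) / 2 * (2 * (1 + s) * (1 + B) ^ s + 1) * ‖η‖ ^ 2 * (1 + ‖u‖ ^ (s + 2)) := by
  have hB : 0 ≤ B := (norm_nonneg η).trans hη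
  have hsq : ‖u + η‖ ^ 2 = ‖u‖ ^ 2 + 2 * ⟪η, u⟫ + ‖η‖ ^ 2 := by
    rw [norm_add_sq_real, real_inner_comm]
  have hle : ‖u + η‖ ≤ ‖u‖ + ‖η‖ := norm_add_le u η
  have hge : ‖u‖ ≤ ‖u + η‖ + ‖η‖ := by simpa using norm_sub_le (u + η) η
  have hdiff : (‖u + η‖ - ‖u‖) ^ 2 ≤ ‖η‖ ^ 2 := sq_le_sq' (by linarith) (by linarith)
  have hgrad := rpow_add_two_sub_le hs (norm_nonneg (u + η)) (norm_nonneg u)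
  have hmono : ∀ M : ℝ, 0 ≤ M → M ≤ ‖u‖ + B →
      2 * (1 + s) * M ^ s * (‖u + η‖ - ‖u‖) ^ 2
        ≤ 2 * (1 + s) * ((1 + B) ^ s * (1 + ‖u‖ ^ (s + 2))) * ‖η‖ ^ 2 := by
    intro M hM0 hM
    have h := (Real.rpow_le_rpow hM0 hM hs.le).trans (add_rpow_le hs.le (norm_nonneg u) hB)
    gcongr
  have hcross : (‖u + η‖ ^ s - ‖u‖ ^ s) * (‖u + η‖ ^ 2 - ‖u‖ ^ 2)
      ≤ 2 * (1 + s) * ((1 + B) ^ s * (1 + ‖u‖ ^ (s + 2))) * ‖η‖ ^ 2 := by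
    rcases le_total ‖u‖ ‖u + η‖ with h | h
    · exact (rpow_sub_mul_sq_sub_le hs.le (norm_nonneg u) h).trans
        (hmono _ (norm_nonneg _) (by linarith))
    · have h1 := rpow_sub_mul_sq_sub_le hs.le (norm_nonneg (u + η)) h
      have h2 := hmono ‖u‖ (norm_nonneg _) (by linarith)
      linarith
  have hlow : ‖u‖ ^ s * ‖η‖ ^ 2 ≤ (1 + ‖u‖ ^ (s + 2)) * ‖η‖ ^ 2 := by
    gcongr
    exact rpow_le_one_add_rpow_add_two hs.le (norm_nonneg u)
  have hinner : 2 * ⟪η, u⟫ = ‖u + η‖ ^ 2 - ‖u‖ ^ 2 - ‖η‖ ^ 2 := by linarith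
  calc _ = ‖u + η‖ ^ (s + 2) - ‖u‖ ^ (s + 2)
        - (s + 2) / 2 * (‖u‖ ^ s * (2 * ⟪η, u⟫)) := by ring
    _ ≤ (s + 2) / 2 * ((‖u + η‖ ^ s - ‖u‖ ^ s) * (‖u + η‖ ^ 2 - ‖u‖ ^ 2)
        + ‖u‖ ^ s * ‖η‖ ^ 2) := by
      rw [hinner]
      linarith
    _ ≤ (s + 2) / 2 * (2 * (1 + s) * ((1 + B) ^ s * (1 + ‖u‖ ^ (s + 2))) * ‖η‖ ^ 2
        + (1 + ‖u‖ ^ (s + 2)) * ‖η‖ ^ 2) := by gcongr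
    _ = _ := by ring

/-- Jump increment estimate for the penalty function. -/
theorem penalty_jump_estimate
    (N l : ℕ) (Bh γ : ℝ) (hB : 1 ≤ Bh) (hγ : 0 < γ) :
    ∃ c : ℝ, 1 ≤ c ∧
      ∀ (ε Λ β : ℝ), 0 < ε → 0 < Λ → 0 ≤ β →
      ∀ (xb : Euc N) (tb : ℝ) (z : Euc l), z ≠ 0 →
      ∀ ηx ηy : Euc N, ‖ηx‖ ≤ Bh * min ‖z‖ 1 → ‖ηy‖ ≤ Bh * min ‖z‖ 1 →
      ∀ (x y : Euc N) (t : ℝ), ‖ηx - ηy‖ ≤ Bh * min ‖z‖ 1 * ‖x - y‖ →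
        (phiPen ε Λ β γ xb tb (x + ηx) (y + ηy) t - phiPen ε Λ β γ xb tb x y t
            - ⟪ηx, DxPen ε Λ γ xb x y⟫ - ⟪ηy, DyPen ε Λ γ xb x y⟫
          ≤ (1/(2*ε)) * ‖ηx - ηy‖ ^ 2
            + c * Λ * (min ‖z‖ 1) ^ 2
              * (1 + ‖x - xb‖ ^ (2*γ+2 : ℝ) + ‖y - xb‖ ^ (2*γ+2 : ℝ))) ∧
        ((1/(2*ε)) * ‖ηx - ηy‖ ^ 2
            + c * Λ * (min ‖z‖ 1) ^ 2
              * (1 + ‖x - xb‖ ^ (2*γ+2 : ℝ) + ‖y - xb‖ ^ (2*γ+2 : ℝ))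
          ≤ c * (min ‖z‖ 1) ^ 2
              * ((1/ε) * ‖x - y‖ ^ 2
                + Λ * (1 + ‖x - xb‖ ^ (2*γ+2 : ℝ) + ‖y - xb‖ ^ (2*γ+2 : ℝ)))) := by
  have hone : 1 ≤ (1 + Bh) ^ (2 * γ) := Real.one_le_rpow (by linarith) (by linarith)
  obtain ⟨K, hK⟩ : ∃ K, K = (2 * γ + 2) / 2 * (2 * (1 + 2 * γ) * (1 + Bh) ^ (2 * γ) + 1) :=
    ⟨_, rfl⟩
  have hK1 : 1 ≤ K := by
    rw [hK]
    nlinarith [mul_nonneg hγ.le (zero_le_one.trans hone)]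
  have hB2 : 1 ≤ Bh ^ 2 := one_le_pow₀ hB
  refine ⟨2 * K * Bh ^ 2, by nlinarith, ?_⟩
  intro ε Λ β hε hΛ _ xb tb z _ ηx ηy hx hy x y t hxy
  obtain ⟨m, hm⟩ : ∃ m, m = min ‖z‖ 1 := ⟨_, rfl⟩
  have hm0 : 0 ≤ m := hm ▸ le_min (norm_nonneg z) zero_le_one
  have hm1 : m ≤ 1 := hm ▸ min_le_right _ _
  rw [← hm] at hx hy hxy ⊢
  have hradial : ∀ u η : Euc N, ‖η‖ ≤ Bh * m →
      ‖u + η‖ ^ (2 * γ + 2) - ‖u‖ ^ (2 * γ + 2) - (2 * γ + 2) * ‖u‖ ^ (2 * γ) * ⟪η, u⟫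
        ≤ K * (Bh * m) ^ 2 * (1 + ‖u‖ ^ (2 * γ + 2)) := by
    intro u η hη
    have h := norm_add_rpow_sub_le (u := u) (show 0 < 2 * γ by linarith)
      (hη.trans (mul_le_of_le_one_right (by linarith) hm1))
    rw [← hK] at h
    refine h.trans ?_
    gcongr
  have hX := hradial (x - xb) ηx hx
  have hY := hradial (y - xb) ηy hy
  have hx0 := Real.rpow_nonneg (norm_nonneg (x - xb)) (2 * γ + 2)
  have hy0 := Real.rpow_nonneg (norm_nonneg (y - xb)) (2 * γ + 2)
  constructor
  · have hsq : ‖x + ηx - (y + ηy)‖ ^ 2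
        = ‖x - y‖ ^ 2 + 2 * (⟪ηx, x - y⟫ - ⟪ηy, x - y⟫) + ‖ηx - ηy‖ ^ 2 := by
      rw [add_sub_add_comm, norm_add_sq_real, real_inner_comm, inner_sub_left]
    have hsx : x + ηx - xb = x - xb + ηx := by abel
    have hsy : y + ηy - xb = y - xb + ηy := by abel
    simp only [phiPen, DxPen, DyPen, inner_add_right, inner_neg_right, inner_smul_right, hsq,
      hsx, hsy]
    have hsum := mul_le_mul_of_nonneg_left (add_le_add hX hY) hΛ.le
    have hslack : 0 ≤ Λ * (K * (Bh * m) ^ 2) * (‖x - xb‖ ^ (2 * γ + 2) + ‖y - xb‖ ^ (2 * γ + 2)) := by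
      positivity
    have hhalf : 1 / (2 * ε) = 1 / ε / 2 := by field_simp
    rw [hhalf]
    linarith
  · have hq : ‖ηx - ηy‖ ^ 2 ≤ (Bh * m * ‖x - y‖) ^ 2 := by gcongr
    have hquad : 1 / (2 * ε) * ‖ηx - ηy‖ ^ 2 ≤ 2 * K * Bh ^ 2 * m ^ 2 * (1 / ε * ‖x - y‖ ^ 2) := by
      calc 1 / (2 * ε) * ‖ηx - ηy‖ ^ 2 ≤ 1 / (2 * ε) * (Bh * m * ‖x - y‖) ^ 2 := by gcongr
        _ = 1 / 2 * (Bh ^ 2 * m ^ 2 * (1 / ε * ‖x - y‖ ^ 2)) := by field_simp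
        _ ≤ (2 * K) * (Bh ^ 2 * m ^ 2 * (1 / ε * ‖x - y‖ ^ 2)) := by gcongr; linarith
        _ = _ := by ring
    linarith

end
end

section
/- One-sided large-jump kernel estimate at a doubled maximum: Let γ > 0, ε > 0, Λ > 0, β ≥ 0, x̄ ∈ ℝ^N, t̄ ∈ ℝ, t₀ ∈ ℝ, and φ_ε(x,y,t) = (1/(2ε))|x−y|² + Λ(|x−x̄|^{2γ+2} + |y−x̄|^{2γ+2}) + β(t−t̄)². Let u : ℝ^N → ℝ be upper semicontinuous and v : ℝ^N → ℝ lower semicontinuous, and suppose (x₀,y₀) is a global maximum over ℝ^N×ℝ^N of (x,y) ↦ u(x) − v(y) − φ_ε(x,y,t₀). Let η : ℝ^N×ℝ×ℝ^l → ℝ^N be Borel in z with |η_k(x,t,z)| ≤ B̃ min{|z|,1} and |η_k(x,t,z) − η_k(y,t,z)| ≤ B̃ min{|z|,1}|x−y| for some B̃ ≥ 1, and set p = D_xφ_ε(x₀,y₀,t₀), q = −D_yφ_ε(x₀,y₀,t₀). Then there is a constant c ≥ 1 depending only on N, B̃ and γ such that for every z ∈ ℝ^l∖{0}: [u(x₀+η(x₀,t₀,z))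 − u(x₀) − 1_{{|z|≤1}}(z)⟨η(x₀,t₀,z), p⟩] − [v(y₀+η(y₀,t₀,z)) − v(y₀) − 1_{{|z|≤1}}(z)⟨η(y₀,t₀,z), q⟩] ≤ c·min{|z|,1}²·[ (1/ε)|x₀−y₀|² + Λ(1 + |x₀−x̄|^{2γ+2} + |y₀−x̄|^{2γ+2}) ]. Consequently, if ν is a positive Radon measure on ℝ^l∖{0} with ∫_{0<|z|≤1}|z|²ν(dz) + ν({|z|>1}) ≤ Ã and the two kernel integrals over {|z| ≥ κ} exist for some κ ∈ (0,1), then their difference is bounded above by cÃ·[ (1/ε)|x₀−y₀|² + Λ(1 + |x₀−x̄|^{2γ+2} + |y₀−x̄|^{2γ+2}) ]. -/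
open Set MeasureTheory
open scoped RealInnerProductSpace

noncomputable section

lemma one_sub_rpow_le_s11 {p t : ℝ} (hp : 0 < p) (ht : 0 ≤ t) (ht1 : t ≤ 1) :
    1 - t ^ p ≤ max 1 p * (1 - t) := by
  rcases le_total 1 p with h | h
  · have := one_add_mul_self_le_rpow_one_add (s := t - 1) (by linarith) h
    rw [max_eq_right h]
    rw [add_sub_cancel] at this
    linarith
  · have := Real.rpow_le_rpow_of_exponent_ge' ht ht1 hp.le h
    rw [Real.rpow_one] at this
    rw [max_eq_left h]
    linarith

lemma rpow_sub_rpow_mul_le {p x y : ℝ} (hp : 0 < p) (hx : 0 ≤ x) (hxy : x ≤ y) :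
    (y ^ p - x ^ p) * y ≤ max 1 p * (y - x) * y ^ p := by
  rcases hx.trans hxy |>.eq_or_lt with hy | hy
  · subst hy
    simp [Real.zero_rpow hp.ne']
  · have h := one_sub_rpow_le_s11 hp (div_nonneg hx hy.le) ((div_le_one hy).2 hxy)
    rw [Real.div_rpow hx hy.le] at h
    have hyp : 0 < y ^ p := Real.rpow_pos_of_pos hy p
    have h' := mul_le_mul_of_nonneg_right h (mul_pos hyp hy).le
    have e1 : (1 - x ^ p / y ^ p) * (y ^ p * y) = (y ^ p - x ^ p) * y := by
      field_simp
    have e2 : max 1 p * (1 - x / y) * (y ^ p * y) = max 1 p * (y - x) * y ^ p := by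
      field_simp
    rwa [e1, e2] at h'

lemma rpow_sub_rpow_mul_sub_mul_max_le {p a b : ℝ} (hp : 0 < p) (ha : 0 ≤ a) (hb : 0 ≤ b) :
    (b ^ p - a ^ p) * (b - a) * max a b ≤ max 1 p * (b - a) ^ 2 * max a b ^ p := by
  rcases le_total a b with h | h
  · rw [max_eq_right h]
    nlinarith [mul_le_mul_of_nonneg_right (rpow_sub_rpow_mul_le hp ha h) (sub_nonneg.2 h)]
  · rw [max_eq_left h]
    nlinarith [mul_le_mul_of_nonneg_right (rpow_sub_rpow_mul_le hp hb h) (sub_nonneg.2 h)]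

lemma rpow_add_one_sub_le {p a b : ℝ} (hp : 0 < p) (ha : 0 ≤ a) (hb : 0 ≤ b) :
    b ^ (p + 1) - a ^ (p + 1) ≤ (p + 1) * b ^ p * (b - a) := by
  rcases hb.eq_or_lt with hb | hb
  · subst hb
    rw [Real.zero_rpow hp.ne', Real.zero_rpow (by positivity)]
    have := Real.rpow_nonneg ha (p + 1)
    linarith
  · have h := one_add_mul_self_le_rpow_one_add (s := a / b - 1) (p := p + 1)
      (by linarith [div_nonneg ha hb.le]) (by linarith)
    rw [add_sub_cancel, Real.div_rpow ha hb.le] at h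
    have hbp : 0 < b ^ (p + 1) := Real.rpow_pos_of_pos hb _
    rw [le_div_iff₀ hbp, Real.rpow_add_one hb.ne'] at h
    rw [Real.rpow_add_one hb.ne']
    have e : (1 + (p + 1) * (a / b - 1)) * (b ^ p * b)
        = b ^ p * b - (p + 1) * b ^ p * (b - a) := by
      field_simp
      ring
    linarith

lemma add_rpow_le_one_add_rpow {A K q s : ℝ} (hA : 0 ≤ A) (hK : 0 ≤ K) (hq : 0 ≤ q)
    (hqs : q ≤ s) : (A + K) ^ q ≤ (1 + K) ^ q * (1 + A ^ s) := by
  have h1 : 0 ≤ (1 + K) ^ q := by positivity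
  have h2 : 0 ≤ A ^ s := by positivity
  rcases le_total A 1 with h | h
  · calc (A + K) ^ q ≤ (1 + K) ^ q := by gcongr
      _ ≤ _ := by nlinarith
  · calc (A + K) ^ q ≤ ((1 + K) * A) ^ q := by
          gcongr
          nlinarith
      _ = (1 + K) ^ q * A ^ q := Real.mul_rpow (by positivity) hA
      _ ≤ (1 + K) ^ q * (1 + A ^ s) := by
          gcongr
          linarith [Real.rpow_le_rpow_of_exponent_le h hqs]

lemma norm_add_rpow_le_of_norm_le {E : Type*} [SeminormedAddCommGroup E] {K s : ℝ}
    (hs : 0 ≤ s) (hK : 0 ≤ K) (w h : E)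
    (hh : ‖h‖ ≤ K) :
    ‖w + h‖ ^ s - ‖w‖ ^ s ≤ (1 + K) ^ s * (1 + ‖w‖ ^ s) := by
  have h1 : ‖w + h‖ ^ s ≤ (‖w‖ + K) ^ s := by
    gcongr
    exact (norm_add_le _ _).trans (by gcongr)
  have h2 := add_rpow_le_one_add_rpow (norm_nonneg w) hK hs le_rfl
  have h3 : 0 ≤ ‖w‖ ^ s := by positivity
  linarith

section InnerProductSpace

variable {E : Type*} [NormedAddCommGroup E] [InnerProductSpace ℝ E]

lemma norm_add_rpow_sub_le_s11 {γ : ℝ} (hγ : 0 < γ) (w h : E) :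
    ‖w + h‖ ^ (2*γ+2 : ℝ) - ‖w‖ ^ (2*γ+2 : ℝ) - (2*γ+2) * ‖w‖ ^ (2*γ : ℝ) * ⟪h, w⟫
      ≤ (γ + 1) * (4 * max 1 γ + 1) * ‖h‖ ^ 2 * (‖w‖ + ‖h‖) ^ (2*γ : ℝ) := by
  set a := ‖w‖ ^ 2 with ha
  set b := ‖w + h‖ ^ 2 with hb
  have ha0 : 0 ≤ a := by positivity
  have hb0 : 0 ≤ b := by positivity
  have pw : ∀ (r p : ℝ), 0 ≤ r → r ^ (2 * p) = (r ^ 2) ^ p := fun r p hr => by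
    rw [Real.rpow_mul hr, Real.rpow_two]
  have hab : b - a = 2 * ⟪h, w⟫ + ‖h‖ ^ 2 := by
    rw [hb, norm_add_sq_real, real_inner_comm]
    ring
  have e : 2*γ+2 = 2 * (γ + 1) := by ring
  rw [e, pw _ _ (norm_nonneg _), pw _ _ (norm_nonneg _), pw _ _ (norm_nonneg w), ← ha, ← hb]
  set M := max a b with hM
  have hM0 : 0 ≤ M := ha0.trans (le_max_left _ _)
  have hwh : ‖w + h‖ ≤ ‖w‖ + ‖h‖ := norm_add_le _ _
  have hMle : M ^ γ ≤ (‖w‖ + ‖h‖) ^ (2*γ : ℝ) := by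
    rw [pw _ _ (by positivity)]
    have : M ≤ (‖w‖ + ‖h‖) ^ 2 := by
      refine max_le ?_ ?_
      · rw [ha]
        gcongr
        linarith [norm_nonneg h]
      · rw [hb]
        gcongr
    gcongr
  have hsq : (b - a) ^ 2 ≤ 4 * ‖h‖ ^ 2 * M := by
    have h1 : |‖w + h‖ - ‖w‖| ≤ ‖h‖ := by
      simpa using abs_norm_sub_norm_le (w + h) w
    have h2 : (‖w + h‖ - ‖w‖) ^ 2 ≤ ‖h‖ ^ 2 := sq_le_sq' (by linarith [abs_le.1 h1])
      (abs_le.1 h1).2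
    have h3 : (‖w + h‖ + ‖w‖) ^ 2 ≤ 4 * M := by
      have := le_max_left a b
      have := le_max_right a b
      nlinarith [sq_nonneg (‖w + h‖ - ‖w‖)]
    calc (b - a) ^ 2 = (‖w + h‖ - ‖w‖) ^ 2 * (‖w + h‖ + ‖w‖) ^ 2 := by
          rw [ha, hb]
          ring
      _ ≤ ‖h‖ ^ 2 * (4 * M) := by gcongr
      _ = _ := by ring
  have hkey : (b ^ γ - a ^ γ) * (b - a) ≤ 4 * max 1 γ * ‖h‖ ^ 2 * M ^ γ := by
    rcases hM0.eq_or_lt with h0 | h0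
    · have h1 : a = 0 := le_antisymm (by rw [h0]; exact le_max_left _ _) ha0
      have h2 : b = 0 := le_antisymm (by rw [h0]; exact le_max_right _ _) hb0
      rw [h1, h2]
      simp only [sub_self, mul_zero]
      positivity
    · refine le_of_mul_le_mul_right ?_ h0
      calc _ ≤ max 1 γ * (b - a) ^ 2 * M ^ γ := rpow_sub_rpow_mul_sub_mul_max_le hγ ha0 hb0
        _ ≤ max 1 γ * (4 * ‖h‖ ^ 2 * M) * M ^ γ := by gcongr
        _ = _ := by ring
  have hconv := rpow_add_one_sub_le hγ ha0 hb0
  have haM : a ^ γ ≤ M ^ γ := by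
    gcongr
    exact le_max_left _ _
  calc _ = b ^ (γ + 1) - a ^ (γ + 1) - (γ + 1) * a ^ γ * (b - a - ‖h‖ ^ 2) := by
        rw [hab]
        ring
    _ ≤ (γ + 1) * ((b ^ γ - a ^ γ) * (b - a)) + (γ + 1) * ‖h‖ ^ 2 * a ^ γ := by
        linarith
    _ ≤ (γ + 1) * (4 * max 1 γ * ‖h‖ ^ 2 * M ^ γ) + (γ + 1) * ‖h‖ ^ 2 * M ^ γ := by
        gcongr
    _ = (γ + 1) * (4 * max 1 γ + 1) * ‖h‖ ^ 2 * M ^ γ := by ring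
    _ ≤ _ := by gcongr

lemma norm_add_rpow_sub_le_of_norm_le {γ K m : ℝ} (hγ : 0 < γ) (hK : 0 ≤ K) (hm1 : m ≤ 1) (w h : E) (hh : ‖h‖ ≤ K * m) :
    ‖w + h‖ ^ (2*γ+2 : ℝ) - ‖w‖ ^ (2*γ+2 : ℝ) - (2*γ+2) * ‖w‖ ^ (2*γ : ℝ) * ⟪h, w⟫
      ≤ (γ + 1) * (4 * max 1 γ + 1) * K ^ 2 * (1 + K) ^ (2*γ : ℝ) * m ^ 2
        * (1 + ‖w‖ ^ (2*γ+2 : ℝ)) := by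
  have hhK : ‖h‖ ≤ K := hh.trans (mul_le_of_le_one_right hK hm1)
  calc _ ≤ (γ + 1) * (4 * max 1 γ + 1) * ‖h‖ ^ 2 * (‖w‖ + ‖h‖) ^ (2*γ : ℝ) :=
        norm_add_rpow_sub_le_s11 hγ w h
    _ ≤ (γ + 1) * (4 * max 1 γ + 1) * (K * m) ^ 2 * (‖w‖ + K) ^ (2*γ : ℝ) := by gcongr
    _ ≤ (γ + 1) * (4 * max 1 γ + 1) * (K * m) ^ 2
          * ((1 + K) ^ (2*γ : ℝ) * (1 + ‖w‖ ^ (2*γ+2 : ℝ))) := by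
        gcongr
        exact add_rpow_le_one_add_rpow (norm_nonneg w) hK (by positivity) (by linarith)
    _ = _ := by ring

end InnerProductSpace

lemma Euc.norm_le_sqrt_mul {N : ℕ} {w : Euc N} {r : ℝ} (hr : 0 ≤ r) (h : ∀ k, |w k| ≤ r) :
    ‖w‖ ≤ √N * r := by
  refine le_of_sq_le_sq ?_ (by positivity)
  rw [EuclideanSpace.real_norm_sq_eq, mul_pow, Real.sq_sqrt (by positivity)]
  calc ∑ k, w k ^ 2 ≤ ∑ _k : Fin N, r ^ 2 := by
        refine Finset.sum_le_sum fun k _ => ?_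
        rw [← sq_abs]
        exact pow_le_pow_left₀ (abs_nonneg _) (h k) 2
    _ = N * r ^ 2 := by simp

/-- A constant for the jump increments of `phiPen` when the jumps are bounded by `K`. -/
def jumpConst (γ K : ℝ) : ℝ :=
  2 * ((γ + 1) * (4 * max 1 γ + 1) * K ^ 2 * (1 + K) ^ (2*γ : ℝ) + (1 + K) ^ (2*γ+2 : ℝ))
    + K ^ 2 + 1

lemma one_le_jumpConst {γ K : ℝ} (hγ : 0 < γ) (hK : 0 ≤ K) : 1 ≤ jumpConst γ K := by
  have : 0 ≤ 2 * ((γ + 1) * (4 * max 1 γ + 1) * K ^ 2 * (1 + K) ^ (2*γ : ℝ)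
    + (1 + K) ^ (2*γ+2 : ℝ)) + K ^ 2 := by positivity
  unfold jumpConst
  linarith

/-- If `Q`, `P₁`, `P₂` control the increments of the three parts of the penalty, the total is
controlled by `jumpConst`. -/
lemma jumpConst_bound {γ K ε Λ D A A' m Q P₁ P₂ C : ℝ}
    (hε : 0 < ε) (hΛ : 0 < Λ) (hD : 0 ≤ D) (hA : 0 ≤ A) (hA' : 0 ≤ A')
    (hC0 : 0 ≤ C) (hC : 2 * C ≤ jumpConst γ K) (hcK : K ^ 2 + 1 ≤ jumpConst γ K)
    (hQ : Q ≤ (K ^ 2 + 1) * m ^ 2 * D)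
    (h₁ : P₁ ≤ C * m ^ 2 * (1 + A)) (h₂ : P₂ ≤ C * m ^ 2 * (1 + A')) :
    (1 / ε) * Q + Λ * (P₁ + P₂) ≤ jumpConst γ K * m ^ 2 * ((1/ε) * D + Λ * (1 + A + A')) := by
  have hP : P₁ + P₂ ≤ jumpConst γ K * m ^ 2 * (1 + A + A') := by
    calc P₁ + P₂ ≤ C * m ^ 2 * (1 + A) + C * m ^ 2 * (1 + A') := add_le_add h₁ h₂
      _ ≤ 2 * C * m ^ 2 * (1 + A + A') := by
          have : 0 ≤ C * m ^ 2 * (A + A') := by positivity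
          linarith
      _ ≤ _ := by gcongr
  have hQ' : Q ≤ jumpConst γ K * m ^ 2 * D := hQ.trans (by gcongr)
  calc _ ≤ (1 / ε) * (jumpConst γ K * m ^ 2 * D)
        + Λ * (jumpConst γ K * m ^ 2 * (1 + A + A')) := by gcongr
    _ = _ := by ring

lemma phiPen_sub_sub_inner {N : ℕ} {ε : ℝ} (Λ β γ : ℝ) (xb : Euc N) (tb : ℝ)
    (x y a b : Euc N) (t : ℝ) :
    phiPen ε Λ β γ xb tb (x + a) (y + b) t - phiPen ε Λ β γ xb tb x y t
        - ⟪a, DxPen ε Λ γ xb x y⟫ - ⟪b, DyPen ε Λ γ xb x y⟫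
      = (1 / ε) * (‖a - b‖ ^ 2 / 2)
        + Λ * ((‖x - xb + a‖ ^ (2*γ+2 : ℝ) - ‖x - xb‖ ^ (2*γ+2 : ℝ)
            - (2*γ+2) * ‖x - xb‖ ^ (2*γ : ℝ) * ⟪a, x - xb⟫)
          + (‖y - xb + b‖ ^ (2*γ+2 : ℝ) - ‖y - xb‖ ^ (2*γ+2 : ℝ)
            - (2*γ+2) * ‖y - xb‖ ^ (2*γ : ℝ) * ⟪b, y - xb⟫)) := by
  have e1 : x + a - (y + b) = (x - y) + (a - b) := by abel
  have e2 : x + a - xb = x - xb + a := by abel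
  have e3 : y + b - xb = y - xb + b := by abel
  unfold phiPen DxPen DyPen
  rw [e1, e2, e3, norm_add_sq_real (x - y), real_inner_comm (a - b) (x - y)]
  simp only [inner_add_right, inner_neg_right, inner_smul_right, inner_sub_left]
  ring

lemma phiPen_sub_le {N : ℕ} {ε : ℝ} (hε : 0 < ε) (Λ β γ : ℝ) (xb : Euc N) (tb : ℝ)
    (x y a b : Euc N) (t : ℝ) :
    phiPen ε Λ β γ xb tb (x + a) (y + b) t - phiPen ε Λ β γ xb tb x y t
      ≤ (1 / ε) * (‖x - y‖ ^ 2 / 2 + ‖a - b‖ ^ 2)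
        + Λ * ((‖x - xb + a‖ ^ (2*γ+2 : ℝ) - ‖x - xb‖ ^ (2*γ+2 : ℝ))
          + (‖y - xb + b‖ ^ (2*γ+2 : ℝ) - ‖y - xb‖ ^ (2*γ+2 : ℝ))) := by
  have e1 : x + a - (y + b) = (x - y) + (a - b) := by abel
  have e2 : x + a - xb = x - xb + a := by abel
  have e3 : y + b - xb = y - xb + b := by abel
  have h1 : ‖(x - y) + (a - b)‖ ^ 2 ≤ 2 * ‖x - y‖ ^ 2 + 2 * ‖a - b‖ ^ 2 := by
    nlinarith [norm_add_le (x - y) (a - b), sq_nonneg (‖x - y‖ - ‖a - b‖),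
      norm_nonneg (x - y + (a - b))]
  have h2 : (1 / ε) * (‖(x - y) + (a - b)‖ ^ 2 / 2 - ‖x - y‖ ^ 2 / 2)
      ≤ (1 / ε) * (‖x - y‖ ^ 2 / 2 + ‖a - b‖ ^ 2) := by
    gcongr
    linarith
  unfold phiPen
  rw [e1, e2, e3]
  have e4 : 1 / (2 * ε) = 1 / ε / 2 := by ring
  rw [e4]
  linarith

/-- The pointwise kernel bound with the explicit constant `jumpConst`. -/
lemma kernel_sub_kernel_le {N l : ℕ} {γ K ε Λ : ℝ} (hγ : 0 < γ) (hK : 0 ≤ K) (hε : 0 < ε)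
    (hΛ : 0 < Λ) (β : ℝ) (xb : Euc N) (tb t₀ : ℝ) (u v : Euc N → ℝ) (x₀ y₀ : Euc N)
    (hmax : ∀ x y : Euc N,
      u x - v y - phiPen ε Λ β γ xb tb x y t₀ ≤ u x₀ - v y₀ - phiPen ε Λ β γ xb tb x₀ y₀ t₀)
    (a b : Euc N) (z : Euc l) (ha : ‖a‖ ≤ K * min ‖z‖ 1) (hb : ‖b‖ ≤ K * min ‖z‖ 1)
    (hab : ‖a - b‖ ≤ K * min ‖z‖ 1 * ‖x₀ - y₀‖) :
    (u (x₀ + a) - u x₀ - (if ‖z‖ ≤ 1 then ⟪a, DxPen ε Λ γ xb x₀ y₀⟫ else 0))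
        - (v (y₀ + b) - v y₀ - (if ‖z‖ ≤ 1 then ⟪b, -(DyPen ε Λ γ xb x₀ y₀)⟫ else 0))
      ≤ jumpConst γ K * (min ‖z‖ 1) ^ 2
          * ((1/ε) * ‖x₀ - y₀‖ ^ 2
            + Λ * (1 + ‖x₀ - xb‖ ^ (2*γ+2 : ℝ) + ‖y₀ - xb‖ ^ (2*γ+2 : ℝ))) := by
  have hm := hmax (x₀ + a) (y₀ + b)
  have hC₁ : 0 ≤ (γ + 1) * (4 * max 1 γ + 1) * K ^ 2 * (1 + K) ^ (2*γ : ℝ) := by positivity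
  have hC₂ : 0 ≤ (1 + K) ^ (2*γ+2 : ℝ) := by positivity
  have hcK : K ^ 2 + 1 ≤ jumpConst γ K := by
    unfold jumpConst
    linarith
  have hsq : ‖a - b‖ ^ 2 ≤ K ^ 2 * (min ‖z‖ 1) ^ 2 * ‖x₀ - y₀‖ ^ 2 := by
    rw [← mul_pow, ← mul_pow]
    gcongr
  by_cases hz : ‖z‖ ≤ 1
  · have hs := phiPen_sub_sub_inner (ε := ε) Λ β γ xb tb x₀ y₀ a b t₀
    have key := jumpConst_bound (Q := ‖a - b‖ ^ 2 / 2) hε hΛ (sq_nonneg ‖x₀ - y₀‖)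
      (Real.rpow_nonneg (norm_nonneg (x₀ - xb)) (2*γ+2))
      (Real.rpow_nonneg (norm_nonneg (y₀ - xb)) (2*γ+2)) hC₁
      (by unfold jumpConst; nlinarith) hcK
      (by nlinarith [mul_nonneg (sq_nonneg (min ‖z‖ 1)) (sq_nonneg ‖x₀ - y₀‖),
            sq_nonneg ‖a - b‖])
      (norm_add_rpow_sub_le_of_norm_le hγ hK (min_le_right _ _) (x₀ - xb) a ha)
      (norm_add_rpow_sub_le_of_norm_le hγ hK (min_le_right _ _) (y₀ - xb) b hb)
    simp only [if_pos hz, inner_neg_right]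
    linarith
  · have hz1 : min ‖z‖ 1 = 1 := min_eq_right (not_le.1 hz).le
    rw [hz1] at ha hb hsq ⊢
    have hs := phiPen_sub_le hε Λ β γ xb tb x₀ y₀ a b t₀
    have key := jumpConst_bound (m := 1) (Q := ‖x₀ - y₀‖ ^ 2 / 2 + ‖a - b‖ ^ 2) hε hΛ
      (sq_nonneg ‖x₀ - y₀‖)
      (Real.rpow_nonneg (norm_nonneg (x₀ - xb)) (2*γ+2))
      (Real.rpow_nonneg (norm_nonneg (y₀ - xb)) (2*γ+2)) hC₂
      (by unfold jumpConst; nlinarith) hcK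
      (by nlinarith [sq_nonneg ‖x₀ - y₀‖])
      ((norm_add_rpow_le_of_norm_le (s := 2*γ+2) (by positivity) hK (x₀ - xb) a
        (by linarith)).trans_eq (by rw [one_pow, mul_one]))
      ((norm_add_rpow_le_of_norm_le (s := 2*γ+2) (by positivity) hK (y₀ - xb) b
        (by linarith)).trans_eq (by rw [one_pow, mul_one]))
    simp only [if_neg hz]
    linarith

section LevyMeasure

variable {E : Type*} [NormedAddCommGroup E] [MeasurableSpace E] [BorelSpace E]

lemma integrableOn_min_norm_one_sq_s11 {ν : Measure E}
    (h₁ : IntegrableOn (fun z : E => ‖z‖ ^ 2) {z | 0 < ‖z‖ ∧ ‖z‖ ≤ 1} ν)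
    (h₂ : ν {z : E | 1 < ‖z‖} ≠ ⊤) :
    IntegrableOn (fun z : E => (min ‖z‖ 1) ^ 2) {z | 0 < ‖z‖} ν
      ∧ ∫ z in {z : E | 0 < ‖z‖}, (min ‖z‖ 1) ^ 2 ∂ν
        = (∫ z in {z : E | 0 < ‖z‖ ∧ ‖z‖ ≤ 1}, ‖z‖ ^ 2 ∂ν) + (ν {z : E | 1 < ‖z‖}).toReal := by
  have hS : MeasurableSet {z : E | 0 < ‖z‖ ∧ ‖z‖ ≤ 1} :=
    (measurableSet_lt measurable_const measurable_norm).inter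
      (measurableSet_le measurable_norm measurable_const)
  have hT : MeasurableSet {z : E | 1 < ‖z‖} := measurableSet_lt measurable_const measurable_norm
  have hunion : {z : E | 0 < ‖z‖} = {z : E | 0 < ‖z‖ ∧ ‖z‖ ≤ 1} ∪ {z : E | 1 < ‖z‖} := by
    ext z
    simp only [mem_ofPred_eq, mem_union]
    constructor
    · intro h
      rcases le_or_gt ‖z‖ 1 with h' | h'
      · exact Or.inl ⟨h, h'⟩
      · exact Or.inr h'
    · rintro (h | h)
      · exact h.1
      · linarith
  have hdisj : Disjoint {z : E | 0 < ‖z‖ ∧ ‖z‖ ≤ 1} {z : E | 1 < ‖z‖} :=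
    Set.disjoint_left.2 fun z h h' => absurd h.2 (not_le.2 h')
  have e₁ : EqOn (fun z : E => (min ‖z‖ 1) ^ 2) (fun z => ‖z‖ ^ 2)
      {z : E | 0 < ‖z‖ ∧ ‖z‖ ≤ 1} := fun z hz => by simp only [min_eq_left hz.2]
  have e₂ : EqOn (fun z : E => (min ‖z‖ 1) ^ 2) (fun _ => 1) {z : E | 1 < ‖z‖} :=
    fun z hz => by simp only [min_eq_right (show 1 ≤ ‖z‖ from le_of_lt (by simpa using hz)), one_pow]
  have i₁ := (integrableOn_congr_fun e₁ hS).2 h₁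
  have i₂ := (integrableOn_congr_fun e₂ hT).2 (integrableOn_const (μ := ν) h₂)
  rw [hunion]
  refine ⟨i₁.union i₂, ?_⟩
  rw [setIntegral_union hdisj hT i₁ i₂, setIntegral_congr_fun hS e₁, setIntegral_congr_fun hT e₂]
  simp [Measure.real]

lemma setIntegral_sub_setIntegral_le_of_le_min_norm_one_sq {ν : Measure E} {F G : E → ℝ}
    {C At κ : ℝ} (hC : 0 ≤ C)
    (h₁ : IntegrableOn (fun z : E => ‖z‖ ^ 2) {z | 0 < ‖z‖ ∧ ‖z‖ ≤ 1} ν)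
    (h₂ : ν {z : E | 1 < ‖z‖} ≠ ⊤)
    (hAt : (∫ z in {z : E | 0 < ‖z‖ ∧ ‖z‖ ≤ 1}, ‖z‖ ^ 2 ∂ν)
      + (ν {z : E | 1 < ‖z‖}).toReal ≤ At)
    (hκ : 0 < κ) (hF : IntegrableOn F {z | κ ≤ ‖z‖} ν) (hG : IntegrableOn G {z | κ ≤ ‖z‖} ν)
    (hFG : ∀ z, z ≠ 0 → F z - G z ≤ C * (min ‖z‖ 1) ^ 2) :
    (∫ z in {z | κ ≤ ‖z‖}, F z ∂ν) - (∫ z in {z | κ ≤ ‖z‖}, G z ∂ν) ≤ C * At := by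
  obtain ⟨hi, he⟩ := integrableOn_min_norm_one_sq_s11 h₁ h₂
  have hsub : {z : E | κ ≤ ‖z‖} ⊆ {z | 0 < ‖z‖} := fun z hz => hκ.trans_le hz
  have hS : MeasurableSet {z : E | κ ≤ ‖z‖} := measurableSet_le measurable_const measurable_norm
  rw [← integral_sub hF hG]
  calc _ ≤ ∫ z in {z : E | κ ≤ ‖z‖}, C * (min ‖z‖ 1) ^ 2 ∂ν :=
        setIntegral_mono_on (hF.sub hG) ((hi.mono_set hsub).const_mul C) hS
          fun z hz => hFG z (norm_pos_iff.1 (hsub hz))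
    _ = C * ∫ z in {z : E | κ ≤ ‖z‖}, (min ‖z‖ 1) ^ 2 ∂ν := integral_const_mul _ _
    _ ≤ C * ∫ z in {z : E | 0 < ‖z‖}, (min ‖z‖ 1) ^ 2 ∂ν := by
        refine mul_le_mul_of_nonneg_left (setIntegral_mono_set hi ?_ hsub.eventuallyLE) hC
        exact Filter.Eventually.of_forall fun z => sq_nonneg _
    _ ≤ C * At := by
        rw [he]
        gcongr

end LevyMeasure

/-- One-sided large-jump kernel estimate at a doubled maximum. -/
theorem large_jump_onesided_estimate
    (N l : ℕ) (Bt γ : ℝ) (hB : 1 ≤ Bt) (hγ : 0 < γ) :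
    ∃ c : ℝ, 1 ≤ c ∧
      ∀ (ε Λ β : ℝ), 0 < ε → 0 < Λ → 0 ≤ β →
      ∀ (xb : Euc N) (tb t₀ : ℝ) (u v : Euc N → ℝ),
      UpperSemicontinuous u → LowerSemicontinuous v →
      ∀ η : Euc N → ℝ → Euc l → Euc N,
      (∀ (x : Euc N) (t : ℝ) (z : Euc l) (k : Fin N), |η x t z k| ≤ Bt * min ‖z‖ 1) →
      (∀ (x y : Euc N) (t : ℝ) (z : Euc l) (k : Fin N),
        |η x t z k - η y t z k| ≤ Bt * min ‖z‖ 1 * ‖x - y‖) →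
      ∀ x₀ y₀ : Euc N,
      (∀ x y : Euc N,
        u x - v y - phiPen ε Λ β γ xb tb x y t₀
          ≤ u x₀ - v y₀ - phiPen ε Λ β γ xb tb x₀ y₀ t₀) →
      -- pointwise kernel bound
      ((∀ z : Euc l, z ≠ 0 →
        (u (x₀ + η x₀ t₀ z) - u x₀
            - (if ‖z‖ ≤ 1 then ⟪η x₀ t₀ z, DxPen ε Λ γ xb x₀ y₀⟫ else 0))
          - (v (y₀ + η y₀ t₀ z) - v y₀
            - (if ‖z‖ ≤ 1 then ⟪η y₀ t₀ z, -(DyPen ε Λ γ xb x₀ y₀)⟫ else 0))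
        ≤ c * (min ‖z‖ 1) ^ 2
            * ((1/ε) * ‖x₀ - y₀‖ ^ 2
              + Λ * (1 + ‖x₀ - xb‖ ^ (2*γ+2 : ℝ) + ‖y₀ - xb‖ ^ (2*γ+2 : ℝ)))) ∧
      -- integral consequence
      (∀ (ν : Measure (Euc l)) (At : ℝ), 1 ≤ At →
        IntegrableOn (fun z : Euc l => ‖z‖ ^ 2) {z | 0 < ‖z‖ ∧ ‖z‖ ≤ 1} ν →
        ν {z : Euc l | 1 < ‖z‖} ≠ ⊤ →
        (∫ z in {z : Euc l | 0 < ‖z‖ ∧ ‖z‖ ≤ 1}, ‖z‖ ^ 2 ∂ν)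
          + (ν {z : Euc l | 1 < ‖z‖}).toReal ≤ At →
        ∀ κ ∈ Ioo (0:ℝ) 1,
        IntegrableOn (fun z : Euc l =>
          u (x₀ + η x₀ t₀ z) - u x₀
            - (if ‖z‖ ≤ 1 then ⟪η x₀ t₀ z, DxPen ε Λ γ xb x₀ y₀⟫ else 0))
          {z : Euc l | κ ≤ ‖z‖} ν →
        IntegrableOn (fun z : Euc l =>
          v (y₀ + η y₀ t₀ z) - v y₀
            - (if ‖z‖ ≤ 1 then ⟪η y₀ t₀ z, -(DyPen ε Λ γ xb x₀ y₀)⟫ else 0))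
          {z : Euc l | κ ≤ ‖z‖} ν →
        (∫ z in {z : Euc l | κ ≤ ‖z‖},
            (u (x₀ + η x₀ t₀ z) - u x₀
              - (if ‖z‖ ≤ 1 then ⟪η x₀ t₀ z, DxPen ε Λ γ xb x₀ y₀⟫ else 0)) ∂ν)
          - (∫ z in {z : Euc l | κ ≤ ‖z‖},
              (v (y₀ + η y₀ t₀ z) - v y₀
                - (if ‖z‖ ≤ 1 then ⟪η y₀ t₀ z, -(DyPen ε Λ γ xb x₀ y₀)⟫ else 0)) ∂ν)
          ≤ c * At
            * ((1/ε) * ‖x₀ - y₀‖ ^ 2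
              + Λ * (1 + ‖x₀ - xb‖ ^ (2*γ+2 : ℝ) + ‖y₀ - xb‖ ^ (2*γ+2 : ℝ))))) := by
  have hK : 0 ≤ √N * Bt := by positivity
  refine ⟨jumpConst γ (√N * Bt), one_le_jumpConst hγ hK, ?_⟩
  intro ε Λ β hε hΛ _ xb tb t₀ u v _ _ η hη hηL x₀ y₀ hmax
  have hm0 : ∀ z : Euc l, 0 ≤ min ‖z‖ 1 := fun z => le_min (norm_nonneg z) zero_le_one
  have hη' : ∀ x z, ‖η x t₀ z‖ ≤ √N * Bt * min ‖z‖ 1 := fun x z => by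
    rw [mul_assoc]
    exact Euc.norm_le_sqrt_mul (mul_nonneg (by linarith) (hm0 z)) (hη x t₀ z)
  have hηL' : ∀ z, ‖η x₀ t₀ z - η y₀ t₀ z‖ ≤ √N * Bt * min ‖z‖ 1 * ‖x₀ - y₀‖ := fun z => by
    rw [mul_assoc √(N : ℝ), mul_assoc √(N : ℝ)]
    exact Euc.norm_le_sqrt_mul
      (mul_nonneg (mul_nonneg (by linarith) (hm0 z)) (norm_nonneg _)) (hηL x₀ y₀ t₀ z)
  have hpt := fun z : Euc l => kernel_sub_kernel_le hγ hK hε hΛ β xb tb t₀ u v x₀ y₀ hmax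
    (η x₀ t₀ z) (η y₀ t₀ z) z (hη' x₀ z) (hη' y₀ z) (hηL' z)
  refine ⟨fun z _ => hpt z, fun ν At _ h₁ h₂ hAt κ hκ hF hG => ?_⟩
  have hc := one_le_jumpConst hγ hK
  rw [mul_right_comm]
  refine setIntegral_sub_setIntegral_le_of_le_min_norm_one_sq (by positivity) h₁ h₂ hAt hκ.1 hF hG
    fun z _ => (hpt z).trans_eq ?_
  ring

end
end
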